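/- arXiv:2304.00124 — 4 statements merged into one kernel-verified Lean document; each statement's English description precedes it below -/
import Mathlib

section
/- Fix s ∈ (−1/2, 0) and set ε = (1/2 + s)/2. There exists a constant C > 0 (depending only on s) such that for all κ ≥ 1 and all measurable functions Q : ℝ → ℂ and F : [0,∞) → ℂ, one has ∫_0^∞ (ξ+κ)^{-1} | ∫_0^∞ Q(ξ-η) F(η) dη |² dξ ≤ C κ^{-4ε} (∫_ℝ (|ξ|+κ)^{2s} |Q(ξ)|² dξ) (∫_0^∞ (ξ+κ) |F(ξ)|² dξ). (This is the Fourier-side form of the estimate ‖C₊ q C₊ f‖_{H^{-1/2}_κ} ≲ κ^{-2ε} ‖q‖_{H^s_κ} ‖f₊‖_{H^{1/2}_κ}.) -/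
open MeasureTheory Set

theorem lintegral_mul_sq_le {α : Type*} [MeasurableSpace α] (μ : Measure α)
    {f g : α → ENNReal} (hf : AEMeasurable f μ) (hg : AEMeasurable g μ) :
    (∫⁻ a, f a * g a ∂μ) ^ 2 ≤ (∫⁻ a, f a ^ 2 ∂μ) * ∫⁻ a, g a ^ 2 ∂μ := by
  have h := ENNReal.lintegral_mul_le_Lp_mul_Lq μ Real.HolderConjugate.two_two hf hg
  simp only [Pi.mul_apply, ENNReal.rpow_two] at h
  calc (∫⁻ a, f a * g a ∂μ) ^ 2
      ≤ ((∫⁻ a, f a ^ 2 ∂μ) ^ (1 / 2 : ℝ) * (∫⁻ a, g a ^ 2 ∂μ) ^ (1 / 2 : ℝ)) ^ 2 := by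
        gcongr
    _ = _ := by
        rw [mul_pow, ← ENNReal.rpow_two, ← ENNReal.rpow_two, ← ENNReal.rpow_mul,
          ← ENNReal.rpow_mul]
        norm_num

theorem lintegral_Ioi_add_rpow {κ r : ℝ} (hκ : 0 < κ) (hr : 0 < r) :
    ∫⁻ η in Ioi (0 : ℝ), ENNReal.ofReal ((η + κ) ^ (-(1 + r))) =
      ENNReal.ofReal (κ ^ (-r) / r) := by
  have hint : IntegrableOn (fun η : ℝ => (η + κ) ^ (-(1 + r))) (Ioi 0) :=
    integrableOn_add_rpow_Ioi_of_lt (by linarith) (by linarith)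
  rw [← ofReal_integral_eq_lintegral_ofReal hint]
  · congr 1
    have h := (measurePreserving_add_right volume κ).setIntegral_preimage_emb
      (measurableEmbedding_addRight κ) (fun x : ℝ => x ^ (-(1 + r))) (Ioi κ)
    rw [preimage_add_const_Ioi, sub_self] at h
    rw [h, integral_Ioi_rpow_of_lt (by linarith) hκ]
    rw [show -(1 + r) + 1 = -r by ring, neg_div_neg_eq]
  · filter_upwards [ae_restrict_mem measurableSet_Ioi] with η hη
    have : (0 : ℝ) < η := hη
    positivity

theorem inv_add_mul_inv_add_le_of_le {κ s x y : ℝ} (hκ : 0 < κ) (hs : -(1 / 2) ≤ s)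
    (hs' : s ≤ 0) (hy : 0 < y) (hyx : y ≤ x) :
    (x + κ)⁻¹ * (y + κ)⁻¹ ≤ (|x - y| + κ) ^ (2 * s) * (y + κ) ^ (-(1 + (1 + 2 * s))) := by
  have hx : 0 < x + κ := by linarith
  have hy' : 0 < y + κ := by linarith
  rw [abs_of_nonneg (sub_nonneg.2 hyx), show -(1 + (1 + 2 * s)) = -(1 + 2 * s) + -1 by ring,
    Real.rpow_add hy', Real.rpow_neg_one, ← mul_assoc]
  gcongr
  calc (x + κ)⁻¹ = (x + κ) ^ (2 * s) * (x + κ) ^ (-(1 + 2 * s)) := by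
        rw [← Real.rpow_add hx, ← Real.rpow_neg_one]; congr 1; ring
    _ ≤ _ := by
        gcongr ?_ * ?_
        · exact Real.rpow_le_rpow_of_nonpos (by linarith) (by linarith) (by linarith)
        · exact Real.rpow_le_rpow_of_nonpos (by linarith) (by linarith) (by linarith)

theorem inv_add_mul_inv_add_le {κ s x y : ℝ} (hκ : 0 < κ) (hs : -(1 / 2) ≤ s)
    (hs' : s ≤ 0) (hx : 0 < x) (hy : 0 < y) :
    (x + κ)⁻¹ * (y + κ)⁻¹ ≤ (|x - y| + κ) ^ (2 * s) *
      ((x + κ) ^ (-(1 + (1 + 2 * s))) + (y + κ) ^ (-(1 + (1 + 2 * s)))) := by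
  rw [mul_add]
  rcases le_total y x with h | h
  · exact (inv_add_mul_inv_add_le_of_le hκ hs hs' hy h).trans
      (le_add_of_nonneg_left (by positivity))
  · rw [mul_comm, abs_sub_comm]
    exact (inv_add_mul_inv_add_le_of_le hκ hs hs' hx h).trans
      (le_add_of_nonneg_right (by positivity))

theorem lintegral_lintegral_sub_mul_add_le {G w : ℝ → ENNReal} (hG : Measurable G)
    (hw : Measurable w) (S : Set ℝ) :
    ∫⁻ ξ in S, ∫⁻ η in S, G (ξ - η) * (w ξ + w η) ≤
      2 * ((∫⁻ u, G u) * ∫⁻ η in S, w η) := by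
  simp only [mul_add]
  have h1 : ∫⁻ ξ in S, ∫⁻ η in S, G (ξ - η) * w ξ ≤ (∫⁻ u, G u) * ∫⁻ η in S, w η := by
    rw [← lintegral_const_mul _ hw]
    refine lintegral_mono fun ξ => ?_
    rw [lintegral_mul_const _ (by fun_prop)]
    gcongr ?_ * _
    exact (setLIntegral_le_lintegral S fun η => G (ξ - η)).trans_eq
      (lintegral_sub_left_eq_self G ξ)
  have h2 : ∫⁻ ξ in S, ∫⁻ η in S, G (ξ - η) * w η ≤ (∫⁻ u, G u) * ∫⁻ η in S, w η := by
    rw [lintegral_lintegral_swap (by fun_prop), ← lintegral_const_mul _ hw]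
    refine lintegral_mono fun η => ?_
    rw [lintegral_mul_const _ (by fun_prop)]
    gcongr ?_ * _
    exact (setLIntegral_le_lintegral S fun ξ => G (ξ - η)).trans_eq
      (lintegral_sub_right_eq_self G η)
  have h3 : ∀ ξ, ∫⁻ η in S, (G (ξ - η) * w ξ + G (ξ - η) * w η) =
      (∫⁻ η in S, G (ξ - η) * w ξ) + ∫⁻ η in S, G (ξ - η) * w η :=
    fun ξ => lintegral_add_left (by fun_prop) _
  simp only [h3]
  rw [lintegral_add_left (Measurable.lintegral_prod_right (by fun_prop)), two_mul]
  exact add_le_add h1 h2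

theorem ofReal_norm_setIntegral_mul_sq_le {κ : ℝ} (hκ : 0 < κ) {q F : ℝ → ℂ}
    (hq : Measurable q) (hF : Measurable F) :
    ENNReal.ofReal (‖∫ η in Ioi (0 : ℝ), q η * F η‖ ^ 2) ≤
      (∫⁻ η in Ioi (0 : ℝ), ENNReal.ofReal ((η + κ)⁻¹ * ‖q η‖ ^ 2)) *
        ∫⁻ η in Ioi (0 : ℝ), ENNReal.ofReal ((η + κ) * ‖F η‖ ^ 2) := by
  calc ENNReal.ofReal (‖∫ η in Ioi (0 : ℝ), q η * F η‖ ^ 2)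
      = ‖∫ η in Ioi (0 : ℝ), q η * F η‖ₑ ^ 2 := by
        rw [ENNReal.ofReal_pow (norm_nonneg _), ofReal_norm]
    _ ≤ (∫⁻ η in Ioi (0 : ℝ), ‖q η * F η‖ₑ) ^ 2 := by
        gcongr
        exact enorm_integral_le_lintegral_enorm _
    _ = (∫⁻ η in Ioi (0 : ℝ), ENNReal.ofReal (√((η + κ)⁻¹) * ‖q η‖) *
          ENNReal.ofReal (√(η + κ) * ‖F η‖)) ^ 2 := by
        congr 1
        refine setLIntegral_congr_fun measurableSet_Ioi fun η hη => ?_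
        have hη' : 0 < η + κ := add_pos hη hκ
        rw [← ENNReal.ofReal_mul (by positivity), ← ofReal_norm, norm_mul,
          mul_mul_mul_comm, ← Real.sqrt_mul (by positivity), inv_mul_cancel₀ hη'.ne',
          Real.sqrt_one, one_mul]
    _ ≤ (∫⁻ η in Ioi (0 : ℝ), ENNReal.ofReal (√((η + κ)⁻¹) * ‖q η‖) ^ 2) *
          ∫⁻ η in Ioi (0 : ℝ), ENNReal.ofReal (√(η + κ) * ‖F η‖) ^ 2 :=
        lintegral_mul_sq_le _ (by fun_prop) (by fun_prop)
    _ = _ := by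
        congr 1 <;>
        · refine setLIntegral_congr_fun measurableSet_Ioi fun η hη => ?_
          have hη' : 0 < η + κ := add_pos hη hκ
          rw [← ENNReal.ofReal_pow (by positivity), mul_pow, Real.sq_sqrt (by positivity)]

/-- Fourier-side form of the estimate
`‖C₊ q C₊ f‖_{H^{-1/2}_κ} ≲ κ^{-2ε} ‖q‖_{H^s_κ} ‖f₊‖_{H^{1/2}_κ}` for `s ∈ (-1/2,0)`,
`ε = (1/2+s)/2`. -/
theorem stmt3 (s : ℝ) (hs : s ∈ Set.Ioo (-(1/2) : ℝ) 0) :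
    ∃ C : ℝ, 0 < C ∧
      ∀ κ : ℝ, 1 ≤ κ →
        ∀ Q F : ℝ → ℂ, Measurable Q → Measurable F →
          (∫⁻ ξ in Ioi (0 : ℝ),
              ENNReal.ofReal ((ξ + κ)⁻¹ *
                ‖∫ η in Ioi (0 : ℝ), Q (ξ - η) * F η‖ ^ 2))
            ≤ ENNReal.ofReal (C * κ ^ (-(4 * ((1/2 + s) / 2)))) *
                (∫⁻ ξ : ℝ, ENNReal.ofReal ((|ξ| + κ) ^ (2 * s) * ‖Q ξ‖ ^ 2)) *
                (∫⁻ ξ in Ioi (0 : ℝ), ENNReal.ofReal ((ξ + κ) * ‖F ξ‖ ^ 2)) := by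
  obtain ⟨hs1, hs2⟩ := hs
  have hr : 0 < 1 + 2 * s := by linarith
  refine ⟨2 / (1 + 2 * s), by positivity, fun κ hκ1 Q F hQ hF => ?_⟩
  have hκ : 0 < κ := by linarith
  set B := ∫⁻ ξ in Ioi (0 : ℝ), ENNReal.ofReal ((ξ + κ) * ‖F ξ‖ ^ 2)
  set G : ℝ → ENNReal := fun u => ENNReal.ofReal ((|u| + κ) ^ (2 * s) * ‖Q u‖ ^ 2) with hG
  set w : ℝ → ENNReal := fun η => ENNReal.ofReal ((η + κ) ^ (-(1 + (1 + 2 * s)))) with hw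
  have hGm : Measurable G := by fun_prop
  have hwm : Measurable w := by fun_prop
  calc _ ≤ ∫⁻ ξ in Ioi (0 : ℝ), (∫⁻ η in Ioi (0 : ℝ), G (ξ - η) * (w ξ + w η)) * B := by
        refine setLIntegral_mono' measurableSet_Ioi fun ξ hξ => ?_
        have hξ' : 0 < ξ + κ := add_pos hξ hκ
        rw [ENNReal.ofReal_mul (by positivity)]
        refine (mul_le_mul_right (ofReal_norm_setIntegral_mul_sq_le hκ
          (q := fun η => Q (ξ - η)) (by fun_prop) hF) _).trans ?_
        rw [← mul_assoc]
        gcongr ?_ * _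
        rw [← lintegral_const_mul _ (by fun_prop)]
        refine setLIntegral_mono' measurableSet_Ioi fun η hη => ?_
        have hη' : 0 < η + κ := add_pos hη hκ
        simp only [hG, hw]
        rw [← ENNReal.ofReal_add (by positivity) (by positivity),
          ← ENNReal.ofReal_mul (by positivity), ← ENNReal.ofReal_mul (by positivity),
          ← mul_assoc, mul_right_comm _ (‖Q (ξ - η)‖ ^ 2)]
        gcongr ENNReal.ofReal (?_ * _)
        exact inv_add_mul_inv_add_le hκ hs1.le hs2.le hξ hη
    _ = (∫⁻ ξ in Ioi (0 : ℝ), ∫⁻ η in Ioi (0 : ℝ), G (ξ - η) * (w ξ + w η)) * B :=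
        lintegral_mul_const _ (Measurable.lintegral_prod_right (by fun_prop))
    _ ≤ 2 * ((∫⁻ u, G u) * ∫⁻ η in Ioi (0 : ℝ), w η) * B := by
        gcongr
        exact lintegral_lintegral_sub_mul_add_le hGm hwm _
    _ = _ := by
        rw [lintegral_Ioi_add_rpow hκ hr, mul_left_comm, mul_comm (∫⁻ u, G u)]
        congr 2
        rw [← ENNReal.ofReal_ofNat 2, ← ENNReal.ofReal_mul (by norm_num),
          show -(4 * ((1 / 2 + s) / 2)) = -(1 + 2 * s) by ring]
        congr 1
        ring
end

section
/- Let q be a real-valued Schwartz function on ℝ, and let f, g be Schwartz functions whose Fourier transforms are supported in [0,∞). Define the Lax operator by Lh = −i h' − C₊(q h), and set q₊ = C₊ q. Then C₊( f · conj(Lg) − conj(g) · Lf ) = i ∂_x ( C₊( f · conj(g) ) ) + f · (1 − C₋)( q₊ · conj(g) ), where conj denotes complex conjugation. -/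
open MeasureTheory Set ComplexConjugate

/-- Fourier transform with the convention `f̂(ξ) = (2π)^{-1/2} ∫ e^{-iξx} f(x) dx`. -/
noncomputable def FT (f : ℝ → ℂ) (ξ : ℝ) : ℂ :=
  (Real.sqrt (2 * Real.pi))⁻¹ * ∫ x : ℝ, Complex.exp (-(Complex.I * ξ * x)) * f x

/-- Cauchy–Szegő projection `C₊`, the Fourier multiplier with symbol `1_{[0,∞)}`. -/
noncomputable def Cplus (f : ℝ → ℂ) (x : ℝ) : ℂ :=
  (Real.sqrt (2 * Real.pi))⁻¹ * ∫ ξ in Ici (0 : ℝ), Complex.exp (Complex.I * ξ * x) * FT f ξ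

/-- Cauchy–Szegő projection `C₋`, the Fourier multiplier with symbol `1_{(-∞,0]}`. -/
noncomputable def Cminus (f : ℝ → ℂ) (x : ℝ) : ℂ :=
  (Real.sqrt (2 * Real.pi))⁻¹ * ∫ ξ in Iic (0 : ℝ), Complex.exp (Complex.I * ξ * x) * FT f ξ

/-- The Lax operator `L h = -i h' - C₊(q h)`. -/
noncomputable def LaxOp (q f : ℝ → ℂ) : ℝ → ℂ :=
  fun x => -Complex.I * deriv f x - Cplus (fun y => q y * f y) x

open scoped FourierTransform SchwartzMap

/-- The inverse Fourier transform in the normalization of `FT`. -/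
noncomputable def invFT (v : ℝ → ℂ) (x : ℝ) : ℂ :=
  (Real.sqrt (2 * Real.pi))⁻¹ * ∫ ξ : ℝ, Complex.exp (Complex.I * ξ * x) * v ξ

/-- Continuous integrable functions with integrable Fourier transform, for which Fourier inversion
holds pointwise. -/
structure IsInvertibleFT (h : ℝ → ℂ) : Prop where
  continuous : Continuous h
  integrable : Integrable h
  integrable_FT : Integrable (FT h)

lemma FT_eq_fourier (f : ℝ → ℂ) (ξ : ℝ) :
    FT f ξ = (Real.sqrt (2 * Real.pi))⁻¹ * 𝓕 f (ξ / (2 * Real.pi)) := by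
  rw [FT, Real.fourier_eq']
  congr 2
  ext x
  have : (Real.pi : ℂ) ≠ 0 := by exact_mod_cast Real.pi_ne_zero
  simp only [RCLike.inner_apply, conj_trivial, smul_eq_mul]
  congr 2
  push_cast
  field_simp

lemma invFT_eq_fourier (v : ℝ → ℂ) (x : ℝ) :
    invFT v x = (Real.sqrt (2 * Real.pi))⁻¹ * 𝓕 v (-x / (2 * Real.pi)) := by
  rw [← FT_eq_fourier, invFT, FT]
  congr 3
  ext ξ
  push_cast
  ring_nf

lemma sqrt_two_pi_inv_mul_self :
    (((Real.sqrt (2 * Real.pi))⁻¹ : ℝ) : ℂ) * ((Real.sqrt (2 * Real.pi))⁻¹ : ℝ) * (2 * Real.pi)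
      = 1 := by
  have h : (Real.sqrt (2 * Real.pi))⁻¹ * (Real.sqrt (2 * Real.pi))⁻¹ * (2 * Real.pi) = 1 := by
    rw [← mul_inv, Real.mul_self_sqrt (by positivity)]
    exact inv_mul_cancel₀ (by positivity)
  exact_mod_cast h

lemma norm_exp_I_mul_mul (ξ x : ℝ) : ‖Complex.exp (Complex.I * ξ * x)‖ = 1 := by
  have : Complex.I * ξ * x = ((ξ * x : ℝ) : ℂ) * Complex.I := by push_cast; ring
  rw [this, Complex.norm_exp_ofReal_mul_I]

lemma norm_exp_neg_I_mul_mul (ξ x : ℝ) : ‖Complex.exp (-(Complex.I * ξ * x))‖ = 1 := by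
  rw [Complex.exp_neg, norm_inv, norm_exp_I_mul_mul, inv_one]

lemma integrable_exp_mul {v : ℝ → ℂ} (hv : Integrable v) (x : ℝ) :
    Integrable fun ξ : ℝ => Complex.exp (Complex.I * ξ * x) * v ξ :=
  hv.bdd_mul (c := 1) (by fun_prop) (.of_forall fun ξ => (norm_exp_I_mul_mul ξ x).le)

lemma integrable_exp_neg_mul {v : ℝ → ℂ} (hv : Integrable v) (ξ : ℝ) :
    Integrable fun x : ℝ => Complex.exp (-(Complex.I * ξ * x)) * v x :=
  hv.bdd_mul (c := 1) (by fun_prop) (.of_forall fun x => (norm_exp_neg_I_mul_mul ξ x).le)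

lemma continuous_invFT {v : ℝ → ℂ} (hv : Integrable v) : Continuous (invFT v) := by
  unfold invFT
  refine continuous_const.mul (continuous_of_dominated (bound := fun ξ => ‖v ξ‖)
    (fun x => (integrable_exp_mul hv x).aestronglyMeasurable) (fun x => .of_forall fun ξ => ?_)
    hv.norm (.of_forall fun ξ => by fun_prop))
  rw [norm_mul, norm_exp_I_mul_mul, one_mul]

lemma norm_invFT_le (v : ℝ → ℂ) (x : ℝ) :
    ‖invFT v x‖ ≤ ‖(((Real.sqrt (2 * Real.pi))⁻¹ : ℝ) : ℂ)‖ * ∫ ξ, ‖v ξ‖ := by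
  rw [invFT, norm_mul]
  gcongr
  refine (norm_integral_le_integral_norm _).trans_eq ?_
  simp [norm_exp_I_mul_mul]

lemma invFT_FT {h : ℝ → ℂ} (hh : IsInvertibleFT h) (x : ℝ) : invFT (FT h) x = h x := by
  have hpi : (2 * Real.pi) ≠ 0 := by positivity
  have hF : Integrable (𝓕 h) := by
    have := (hh.integrable_FT.comp_mul_left' hpi).const_mul
      (((Real.sqrt (2 * Real.pi))⁻¹ : ℝ) * (2 * Real.pi : ℂ))
    refine this.congr (.of_forall fun ξ => ?_)
    simp only [FT_eq_fourier]
    rw [mul_div_cancel_left₀ _ hpi]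
    linear_combination (𝓕 h ξ) * sqrt_two_pi_inv_mul_self
  have key : ∫ ξ : ℝ, Complex.exp (Complex.I * ξ * x) * 𝓕 h (ξ / (2 * Real.pi))
      = (2 * Real.pi) * h x := by
    have := Measure.integral_comp_div
      (fun η : ℝ => Complex.exp (Complex.I * (2 * Real.pi * η) * x) * 𝓕 h η) (2 * Real.pi)
    rw [← congrFun (hh.continuous.fourierInv_fourier_eq hh.integrable hF) x, Real.fourierInv_eq']
    rw [abs_of_pos (by positivity), Complex.real_smul] at this
    push_cast at this
    convert! this using 1
    · congr 1
      ext ξ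
      have : (Real.pi : ℂ) ≠ 0 := by exact_mod_cast Real.pi_ne_zero
      congr 2
      field_simp
    · congr 2
      ext ξ
      simp only [RCLike.inner_apply, conj_trivial, smul_eq_mul]
      congr 2
      push_cast
      ring
  simp only [invFT, FT_eq_fourier, mul_left_comm _ (((Real.sqrt (2 * Real.pi))⁻¹ : ℝ) : ℂ)]
  rw [integral_const_mul, key]
  linear_combination (h x) * sqrt_two_pi_inv_mul_self

lemma Cplus_eq_invFT (h : ℝ → ℂ) : Cplus h = invFT ((Ici 0).indicator (FT h)) := by
  ext x
  rw [Cplus, invFT, ← integral_indicator measurableSet_Ici]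
  simp only [indicator_mul_right]

lemma Cminus_eq_invFT (h : ℝ → ℂ) : Cminus h = invFT ((Iic 0).indicator (FT h)) := by
  ext x
  rw [Cminus, invFT, ← integral_indicator measurableSet_Iic]
  simp only [indicator_mul_right]

lemma Cplus_add_Cminus {h : ℝ → ℂ} (hh : IsInvertibleFT h) (x : ℝ) :
    Cplus h x + Cminus h x = h x := by
  rw [← invFT_FT hh x, Cplus, Cminus, invFT, integral_Ici_eq_integral_Ioi, add_comm, ← mul_add]
  congr 1
  have := integrable_exp_mul hh.integrable_FT x
  exact intervalIntegral.integral_Iic_add_Ioi this.integrableOn this.integrableOn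

lemma Cplus_eq_zero {h : ℝ → ℂ} (hh : ∀ ξ, 0 < ξ → FT h ξ = 0) (x : ℝ) : Cplus h x = 0 := by
  rw [Cplus, integral_Ici_eq_integral_Ioi, setIntegral_eq_zero_of_forall_eq_zero, mul_zero]
  exact fun ξ hξ => by rw [hh ξ hξ, mul_zero]

lemma Cminus_eq_zero {h : ℝ → ℂ} (hh : ∀ ξ, ξ < 0 → FT h ξ = 0) (x : ℝ) : Cminus h x = 0 := by
  rw [Cminus, integral_Iic_eq_integral_Iio, setIntegral_eq_zero_of_forall_eq_zero, mul_zero]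
  exact fun ξ hξ => by rw [hh ξ hξ, mul_zero]

lemma Cplus_eq_self {h : ℝ → ℂ} (hh : IsInvertibleFT h) (h0 : ∀ ξ, ξ < 0 → FT h ξ = 0) (x : ℝ) :
    Cplus h x = h x := by
  rw [← Cplus_add_Cminus hh, Cminus_eq_zero h0, add_zero]

lemma FT_add {h k : ℝ → ℂ} (hh : Integrable h) (hk : Integrable k) :
    FT (fun x => h x + k x) = fun ξ => FT h ξ + FT k ξ := by
  ext ξ
  simp only [FT, mul_add]
  rw [integral_add (integrable_exp_neg_mul hh ξ) (integrable_exp_neg_mul hk ξ), mul_add]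

lemma FT_const_mul (a : ℂ) (h : ℝ → ℂ) : FT (fun x => a * h x) = fun ξ => a * FT h ξ := by
  ext ξ
  simp only [FT, mul_left_comm _ a]
  rw [integral_const_mul, mul_left_comm]

lemma IsInvertibleFT.add {h k : ℝ → ℂ} (hh : IsInvertibleFT h) (hk : IsInvertibleFT k) :
    IsInvertibleFT fun x => h x + k x where
  continuous := hh.continuous.add hk.continuous
  integrable := hh.integrable.add hk.integrable
  integrable_FT := by
    rw [FT_add hh.integrable hk.integrable]
    exact hh.integrable_FT.add hk.integrable_FT

lemma IsInvertibleFT.const_mul {h : ℝ → ℂ} (hh : IsInvertibleFT h) (a : ℂ) :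
    IsInvertibleFT fun x => a * h x where
  continuous := continuous_const.mul hh.continuous
  integrable := hh.integrable.const_mul a
  integrable_FT := by
    rw [FT_const_mul]
    exact hh.integrable_FT.const_mul a

lemma Cplus_add {h k : ℝ → ℂ} (hh : IsInvertibleFT h) (hk : IsInvertibleFT k) (x : ℝ) :
    Cplus (fun y => h y + k y) x = Cplus h x + Cplus k x := by
  simp only [Cplus, FT_add hh.integrable hk.integrable, mul_add]
  rw [integral_add (integrable_exp_mul hh.integrable_FT x).integrableOn
    (integrable_exp_mul hk.integrable_FT x).integrableOn, mul_add]

lemma Cplus_const_mul (a : ℂ) (h : ℝ → ℂ) (x : ℝ) :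
    Cplus (fun y => a * h y) x = a * Cplus h x := by
  simp only [Cplus, FT_const_mul, mul_left_comm _ a]
  rw [integral_const_mul, mul_left_comm]

lemma SchwartzMap.isInvertibleFT (h : 𝓢(ℝ, ℂ)) : IsInvertibleFT h where
  continuous := h.continuous
  integrable := h.integrable
  integrable_FT := by
    have := ((𝓕 h).integrable (μ := volume)).comp_div (R := 2 * Real.pi) (by positivity)
    refine (this.const_mul (((Real.sqrt (2 * Real.pi))⁻¹ : ℝ) : ℂ)).congr (.of_forall fun ξ => ?_)
    rw [FT_eq_fourier, SchwartzMap.fourier_coe]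

lemma FT_conj (h : ℝ → ℂ) (ξ : ℝ) : FT (fun x => conj (h x)) ξ = conj (FT h (-ξ)) := by
  rw [FT, FT, map_mul, Complex.conj_ofReal, ← integral_conj]
  congr 2
  ext x
  simp [← Complex.exp_conj]

lemma conj_Cplus (h : ℝ → ℂ) (x : ℝ) : conj (Cplus h x) = Cminus (fun y => conj (h y)) x := by
  rw [Cplus, Cminus, map_mul, Complex.conj_ofReal, ← integral_conj, integral_Ici_eq_integral_Ioi,
    ← neg_zero, ← integral_comp_neg_Iic, neg_zero]
  simp only [FT_conj, map_mul, ← Complex.exp_conj]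
  simp

lemma FT_deriv (h : 𝓢(ℝ, ℂ)) (ξ : ℝ) :
    FT (deriv h) ξ = Complex.I * ξ * FT h ξ := by
  have hd : Integrable (deriv h) := (SchwartzMap.derivCLM ℂ ℂ h).integrable
  rw [FT_eq_fourier, FT_eq_fourier, Real.fourier_deriv h.integrable h.differentiable hd]
  have : (Real.pi : ℂ) ≠ 0 := by exact_mod_cast Real.pi_ne_zero
  simp only [smul_eq_mul]
  push_cast
  field_simp

lemma Cplus_deriv (h : 𝓢(ℝ, ℂ)) (x : ℝ) : Cplus (deriv h) x = deriv (Cplus h) x := by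
  have hv : Integrable ((Ici 0).indicator (FT h)) :=
    h.isInvertibleFT.integrable_FT.indicator measurableSet_Ici
  have hd : Integrable (FT (deriv h)) := (SchwartzMap.derivCLM ℂ ℂ h).isInvertibleFT.integrable_FT
  have hsymb : (Ici 0).indicator (FT (deriv h))
      = fun ξ : ℝ => Complex.I * (ξ • (Ici 0).indicator (FT h) ξ) := by
    ext ξ
    by_cases hξ : ξ ∈ Ici (0 : ℝ) <;> simp [hξ, FT_deriv, mul_assoc]
  have hxv : Integrable fun ξ : ℝ => ξ • (Ici 0).indicator (FT h) ξ := by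
    refine ((hd.indicator (measurableSet_Ici (a := (0 : ℝ)))).const_mul (-Complex.I)).congr
      (.of_forall fun ξ => ?_)
    simp only [hsymb]
    rw [← mul_assoc]
    simp
  have hF := (Real.hasDerivAt_fourier hv hxv (-x / (2 * Real.pi))).scomp x
    ((hasDerivAt_id x).neg.div_const (2 * Real.pi))
  have hF' := hF.const_mul (((Real.sqrt (2 * Real.pi))⁻¹ : ℝ) : ℂ)
  have hfun : Cplus h = fun x => (((Real.sqrt (2 * Real.pi))⁻¹ : ℝ) : ℂ) *
      𝓕 ((Ici 0).indicator (FT h)) (-x / (2 * Real.pi)) := by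
    ext y
    rw [Cplus_eq_invFT, invFT_eq_fourier]
  rw [hfun]
  refine Eq.trans ?_ hF'.deriv.symm
  rw [Cplus_eq_invFT, invFT_eq_fourier, hsymb, Real.fourier_eq', Real.fourier_eq', ← integral_smul]
  congr 2
  ext ξ
  have : (Real.pi : ℂ) ≠ 0 := by exact_mod_cast Real.pi_ne_zero
  simp only [smul_eq_mul, Complex.real_smul]
  push_cast
  field_simp

lemma IsInvertibleFT.integrable_mul_invFT {u v : ℝ → ℂ} (hu : IsInvertibleFT u)
    (hv : Integrable v) : Integrable fun x => u x * invFT v x :=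
  hu.integrable.mul_bdd (continuous_invFT hv).aestronglyMeasurable
    (.of_forall (norm_invFT_le v))

lemma FT_mul_invFT {u v : ℝ → ℂ} (hu : Integrable u) (hv : Integrable v) (ξ : ℝ) :
    FT (fun x => u x * invFT v x) ξ
      = (Real.sqrt (2 * Real.pi))⁻¹ * ∫ η, v η * FT u (ξ - η) := by
  have hint : Integrable (Function.uncurry fun x η : ℝ =>
      Complex.exp (-(Complex.I * (ξ - η : ℝ) * x)) * (u x * v η)) (volume.prod volume) := by
    refine (hu.mul_prod hv).bdd_mul (c := 1) ?_ (.of_forall fun p => ?_)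
    · exact Continuous.aestronglyMeasurable (by fun_prop)
    · exact (norm_exp_neg_I_mul_mul (ξ - p.2) p.1).le
  have hswap := integral_integral_swap hint
  simp only [FT, invFT]
  congr 1
  have hl (x : ℝ) : Complex.exp (-(Complex.I * ξ * x)) *
      (u x * ((((Real.sqrt (2 * Real.pi))⁻¹ : ℝ) : ℂ) *
        ∫ η : ℝ, Complex.exp (Complex.I * η * x) * v η))
      = (((Real.sqrt (2 * Real.pi))⁻¹ : ℝ) : ℂ) *
        ∫ η : ℝ, Complex.exp (-(Complex.I * (ξ - η : ℝ) * x)) * (u x * v η) := by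
    have (η : ℝ) : Complex.exp (-(Complex.I * (ξ - η : ℝ) * x)) * (u x * v η)
        = Complex.exp (-(Complex.I * ξ * x)) * u x * (Complex.exp (Complex.I * η * x) * v η) := by
      have : -(Complex.I * (ξ - η : ℝ) * x) = -(Complex.I * ξ * x) + Complex.I * η * x := by
        push_cast
        ring
      rw [this, Complex.exp_add]
      ring
    simp only [this]
    rw [integral_const_mul]
    ring
  have hr (η : ℝ) : v η * ((((Real.sqrt (2 * Real.pi))⁻¹ : ℝ) : ℂ) *
      ∫ x : ℝ, Complex.exp (-(Complex.I * (ξ - η : ℝ) * x)) * u x)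
      = (((Real.sqrt (2 * Real.pi))⁻¹ : ℝ) : ℂ) *
        ∫ x : ℝ, Complex.exp (-(Complex.I * (ξ - η : ℝ) * x)) * (u x * v η) := by
    simp only [← mul_assoc]
    rw [integral_mul_const]
    ring
  simp only [hl, hr]
  rw [integral_const_mul, integral_const_mul, hswap]

lemma IsInvertibleFT.mul_invFT {u v : ℝ → ℂ} (hu : IsInvertibleFT u) (hv : Integrable v) :
    IsInvertibleFT fun x => u x * invFT v x where
  continuous := hu.continuous.mul (continuous_invFT hv)
  integrable := hu.integrable_mul_invFT hv
  integrable_FT := by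
    have := (hv.convolution_integrand (ContinuousLinearMap.mul ℂ ℂ)
      hu.integrable_FT).integral_prod_left
    refine (this.const_mul (((Real.sqrt (2 * Real.pi))⁻¹ : ℝ) : ℂ)).congr (.of_forall fun ξ => ?_)
    simp [FT_mul_invFT hu.integrable hv]

lemma IsInvertibleFT.mul_Cplus {u h : ℝ → ℂ} (hu : IsInvertibleFT u) (hh : IsInvertibleFT h) :
    IsInvertibleFT fun x => u x * Cplus h x := by
  rw [Cplus_eq_invFT]
  exact hu.mul_invFT (hh.integrable_FT.indicator measurableSet_Ici)

lemma IsInvertibleFT.mul_Cminus {u h : ℝ → ℂ} (hu : IsInvertibleFT u) (hh : IsInvertibleFT h) :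
    IsInvertibleFT fun x => u x * Cminus h x := by
  rw [Cminus_eq_invFT]
  exact hu.mul_invFT (hh.integrable_FT.indicator measurableSet_Iic)

lemma Cplus_mul_Cplus {u h : ℝ → ℂ} (hu : IsInvertibleFT u) (hh : IsInvertibleFT h)
    (h0 : ∀ ξ, ξ < 0 → FT u ξ = 0) (x : ℝ) :
    Cplus (fun y => u y * Cplus h y) x = u x * Cplus h x := by
  refine Cplus_eq_self (hu.mul_Cplus hh) (fun ξ hξ => ?_) x
  rw [Cplus_eq_invFT, FT_mul_invFT hu.integrable (hh.integrable_FT.indicator measurableSet_Ici),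
    integral_eq_zero_of_ae, mul_zero]
  refine .of_forall fun η => ?_
  by_cases hη : 0 ≤ η
  · simp [h0 (ξ - η) (by linarith)]
  · simp [hη]

lemma Cplus_mul_Cminus {u h : ℝ → ℂ} (hu : IsInvertibleFT u) (hh : IsInvertibleFT h)
    (h0 : ∀ ξ, 0 < ξ → FT u ξ = 0) (x : ℝ) :
    Cplus (fun y => u y * Cminus h y) x = 0 := by
  refine Cplus_eq_zero (fun ξ hξ => ?_) x
  rw [Cminus_eq_invFT, FT_mul_invFT hu.integrable (hh.integrable_FT.indicator measurableSet_Iic),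
    integral_eq_zero_of_ae, mul_zero]
  refine .of_forall fun η => ?_
  by_cases hη : η ≤ 0
  · simp [h0 (ξ - η) (by linarith)]
  · simp [hη]

/-- The pointwise product of two Schwartz functions. -/
noncomputable def SchwartzMap.mulSchwartz (f g : 𝓢(ℝ, ℂ)) : 𝓢(ℝ, ℂ) :=
  SchwartzMap.pairing (ContinuousLinearMap.mul ℂ ℂ) f g

/-- The pointwise complex conjugate of a Schwartz function. -/
noncomputable def SchwartzMap.conjSchwartz (g : 𝓢(ℝ, ℂ)) : 𝓢(ℝ, ℂ) :=
  SchwartzMap.postcompCLM (𝕜 := ℝ) (Complex.conjCLE : ℂ →L[ℝ] ℂ) g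

/-- For real-valued Schwartz `q` and Schwartz `f, g` with Fourier support in
`[0,∞)`: `C₊(f conj(Lg) - conj(g) Lf) = i ∂ₓ C₊(f conj g) + f (1 - C₋)(q₊ conj g)`. -/
theorem stmt7 (q f g : SchwartzMap ℝ ℂ) (hq : ∀ x : ℝ, (q x).im = 0)
    (hf : ∀ ξ : ℝ, ξ < 0 → FT (⇑f) ξ = 0) (hg : ∀ ξ : ℝ, ξ < 0 → FT (⇑g) ξ = 0) :
    ∀ x : ℝ,
      Cplus (fun y => f y * conj (LaxOp (⇑q) (⇑g) y) - conj (g y) * LaxOp (⇑q) (⇑f) y) x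
        = Complex.I * deriv (fun y => Cplus (fun z => f z * conj (g z)) y) x
          + f x * (Cplus (⇑q) x * conj (g x)
              - Cminus (fun y => Cplus (⇑q) y * conj (g y)) x) := by
  intro x
  set gb : 𝓢(ℝ, ℂ) := g.conjSchwartz
  have hgb (y : ℝ) : conj (g y) = gb y := rfl
  have hgb0 : ∀ ξ : ℝ, 0 < ξ → FT gb ξ = 0 := fun ξ hξ => by
    have := FT_conj g ξ
    rw [hg (-ξ) (by linarith), map_zero] at this
    exact this
  have hqf : IsInvertibleFT fun y => q y * f y := (q.mulSchwartz f).isInvertibleFT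
  have hqgb : IsInvertibleFT fun y => q y * gb y := (q.mulSchwartz gb).isInvertibleFT
  have hconj (y : ℝ) : conj (Cplus (fun z => q z * g z) y) = Cminus (fun z => q z * gb z) y := by
    have (z : ℝ) : conj (q z) = q z := Complex.conj_eq_iff_im.2 (hq z)
    simp only [conj_Cplus, map_mul, this, hgb]
  have hderiv (y : ℝ) : deriv (f.mulSchwartz gb) y = deriv f y * gb y + f y * conj (deriv g y) := by
    have hg' : HasDerivAt gb (conj (deriv g y)) y :=
      (Complex.conjCLE : ℂ →L[ℝ] ℂ).hasFDerivAt.comp_hasDerivAt y g.differentiableAt.hasDerivAt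
    exact (f.differentiableAt.hasDerivAt.mul hg').deriv
  have hsplit : (fun y => f y * conj (LaxOp q g y) - conj (g y) * LaxOp q f y)
      = fun y => (Complex.I * deriv (f.mulSchwartz gb) y
        + f y * Cplus (fun z => q z * gb z) y)
        + (-1) * (gb y * Cminus (fun z => q z * f z) y) := by
    ext y
    have h1 := Cplus_add_Cminus hqf y
    have h2 := Cplus_add_Cminus hqgb y
    simp only [LaxOp, map_sub, map_mul, map_neg, Complex.conj_I, hconj, hderiv, hgb]
    linear_combination (gb y) * h1 - (f y) * h2
  have hD : IsInvertibleFT (deriv (f.mulSchwartz gb)) :=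
    (SchwartzMap.derivCLM ℂ ℂ (f.mulSchwartz gb)).isInvertibleFT
  have hfP := f.isInvertibleFT.mul_Cplus hqgb
  have hgN := gb.isInvertibleFT.mul_Cminus hqf
  have hgq : IsInvertibleFT fun y => Cplus q y * gb y := by
    simpa only [mul_comm] using gb.isInvertibleFT.mul_Cplus q.isInvertibleFT
  have hqplus : Cplus q x * gb x - Cminus (fun y => Cplus q y * gb y) x
      = Cplus (fun y => q y * gb y) x := by
    have hsplit' : (fun y => q y * gb y) = fun y => Cplus q y * gb y + gb y * Cminus q y := by
      ext y
      rw [← Cplus_add_Cminus q.isInvertibleFT y]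
      ring
    rw [hsplit', Cplus_add hgq (gb.isInvertibleFT.mul_Cminus q.isInvertibleFT),
      Cplus_mul_Cminus gb.isInvertibleFT q.isInvertibleFT hgb0]
    linear_combination -Cplus_add_Cminus hgq x
  rw [hsplit, Cplus_add ((hD.const_mul _).add hfP) (hgN.const_mul _), Cplus_add (hD.const_mul _) hfP,
    Cplus_const_mul, Cplus_const_mul, Cplus_mul_Cminus gb.isInvertibleFT hqf hgb0,
    Cplus_mul_Cplus f.isInvertibleFT hqgb hf, Cplus_deriv]
  simp only [hgb, hqplus]
  rw [mul_zero, add_zero]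
  rfl
end

section
/- Let q be a smooth real-valued function on the circle ℝ/ℤ, let κ > 0, and let m be a smooth complex-valued function on ℝ/ℤ whose Fourier coefficients m̂(ξ) vanish for all frequencies ξ ∈ 2πℤ with ξ < 0, and which solves m' = −iκ m + i C₊(q(m+1)), where C₊ retains exactly the Fourier modes with frequency ξ ≥ 0. Then κ ∫_0^1 m(x) dx = ∫_0^1 q(x) m(x) dx + ∫_0^1 q(x) dx, and moreover ∫_0^1 m(x) dx = ∫_0^1 conj(m)(x) dx (i.e., ∫ m is real). -/
open MeasureTheory Set ComplexConjugate

/-- Fourier coefficient of a `1`-periodic function at frequency `ξ = 2πk`: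
`f̂(2πk) = ∫_0^1 e^{-2πikx} f(x) dx`. -/
noncomputable def fcoeff (f : ℝ → ℂ) (k : ℤ) : ℂ :=
  ∫ x in (0 : ℝ)..1, Complex.exp (-(Complex.I * (2 * Real.pi * (k : ℝ)) * x)) * f x

/-- On the circle, `C₊` retains exactly the Fourier modes with frequency `ξ = 2πk ≥ 0`. -/
noncomputable def CplusCircle (f : ℝ → ℂ) (x : ℝ) : ℂ :=
  ∑' k : ℕ, fcoeff f (k : ℤ) * Complex.exp (Complex.I * (2 * Real.pi * (k : ℝ)) * x)

/-- The Fourier mode `x ↦ e^{2πikx}`. -/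
noncomputable def fmode (k : ℤ) (x : ℝ) : ℂ :=
  Complex.exp (Complex.I * (2 * Real.pi * (k : ℝ)) * x)

lemma continuous_fmode (k : ℤ) : Continuous (fmode k) := by
  unfold fmode; fun_prop

lemma norm_fmode (k : ℤ) (x : ℝ) : ‖fmode k x‖ = 1 := by
  rw [fmode, show Complex.I * (2 * Real.pi * (k : ℝ)) * x
    = ((2 * Real.pi * (k : ℝ) * x : ℝ) : ℂ) * Complex.I by push_cast; ring]
  exact Complex.norm_exp_ofReal_mul_I _

lemma fmode_neg (k : ℤ) (x : ℝ) :
    fmode (-k) x = Complex.exp (-(Complex.I * (2 * Real.pi * (k : ℝ)) * x)) := by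
  unfold fmode; congr 1; push_cast; ring

lemma conj_fmode (k : ℤ) (x : ℝ) : conj (fmode k x) = fmode (-k) x := by
  rw [fmode, fmode, ← Complex.exp_conj]
  congr 1
  simp [Complex.conj_ofNat]

lemma fmode_one (k : ℤ) : fmode k 1 = 1 := by
  rw [fmode, Complex.exp_eq_one_iff]
  exact ⟨k, by push_cast; ring⟩

lemma fmode_at_zero (k : ℤ) : fmode k 0 = 1 := by
  simp [fmode]

lemma hasDerivAt_fmode (k : ℤ) (x : ℝ) :
    HasDerivAt (fmode k) (2 * Real.pi * k * Complex.I * fmode k x) x := by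
  have h : HasDerivAt (fun y : ℝ => Complex.I * (2 * Real.pi * (k : ℝ)) * (y : ℂ))
      (Complex.I * (2 * Real.pi * (k : ℝ)) * 1) x :=
    (Complex.ofRealCLM.hasDerivAt (x := x)).const_mul _
  refine h.cexp.congr_deriv ?_
  simp only [fmode]
  push_cast
  ring

lemma fcoeff_eq (f : ℝ → ℂ) (k : ℤ) : fcoeff f k = ∫ x in (0 : ℝ)..1, fmode (-k) x * f x := by
  simp only [fcoeff, fmode_neg]

lemma norm_fcoeff_le (f : ℝ → ℂ) (k : ℤ) : ‖fcoeff f k‖ ≤ ∫ x in (0 : ℝ)..1, ‖f x‖ := by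
  rw [fcoeff_eq]
  refine (intervalIntegral.norm_integral_le_integral_norm zero_le_one).trans_eq ?_
  simp [norm_fmode]

lemma fcoeff_deriv {f : ℝ → ℂ} (hf : ContDiff ℝ 1 f) (hper : ∀ x, f (x + 1) = f x) (k : ℤ) :
    fcoeff (deriv f) k = 2 * Real.pi * k * Complex.I * fcoeff f k := by
  have hf' : Continuous (deriv f) := hf.continuous_deriv le_rfl
  have h := intervalIntegral.integral_mul_deriv_eq_deriv_mul (a := 0) (b := 1)
    (fun x _ => hasDerivAt_fmode (-k) x)
    (fun x _ => (hf.differentiable one_ne_zero x).hasDerivAt)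
    (((continuous_fmode (-k)).const_mul _).intervalIntegrable _ _)
    (hf'.intervalIntegrable _ _)
  have h01 : f 1 = f 0 := by simpa using hper 0
  rw [fcoeff_eq, fcoeff_eq, h, fmode_one, fmode_at_zero, h01, sub_self, zero_sub,
    ← intervalIntegral.integral_const_mul, ← intervalIntegral.integral_neg]
  congr 1
  ext x
  push_cast
  ring

lemma periodic_deriv {f : ℝ → ℂ} (hper : ∀ x, f (x + 1) = f x) (x : ℝ) :
    deriv f (x + 1) = deriv f x := by
  rw [← deriv_comp_add_const, funext hper]

lemma summable_fcoeff {f : ℝ → ℂ} (hf : ContDiff ℝ 2 f) (hper : ∀ x, f (x + 1) = f x) :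
    Summable (fcoeff f) := by
  set C := ∫ x in (0 : ℝ)..1, ‖deriv (deriv f) x‖
  have hf' : ContDiff ℝ 1 (deriv f) := by
    have h : ContDiff ℝ (1 + 1) f := by norm_num; exact hf
    exact (contDiff_succ_iff_deriv.1 h).2.2
  have hb (k : ℤ) : (2 * Real.pi * |(k : ℝ)|) ^ 2 * ‖fcoeff f k‖ ≤ C := by
    have h := norm_fcoeff_le (deriv (deriv f)) k
    rw [fcoeff_deriv hf' (periodic_deriv hper), fcoeff_deriv (hf.of_le (by norm_num)) hper] at h
    refine le_of_eq_of_le ?_ h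
    simp [abs_of_pos Real.pi_pos]
    ring
  refine Summable.of_norm_bounded_eventually
    ((Real.summable_one_div_int_pow.2 one_lt_two).mul_left C) ?_
  filter_upwards [(Set.finite_singleton (0 : ℤ)).compl_mem_cofinite] with k hk
  have hk0 : (k : ℝ) ≠ 0 := by exact_mod_cast hk
  have hk2 : 0 < (k : ℝ) ^ 2 := by positivity
  rw [mul_one_div, le_div_iff₀ hk2]
  refine le_trans ?_ (hb k)
  rw [mul_pow, sq_abs, mul_comm, mul_assoc]
  refine le_mul_of_one_le_left (by positivity) ?_
  nlinarith [Real.pi_gt_three]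

lemma hasSum_fcoeff_mul_fmode {f : ℝ → ℂ} (hf : Continuous f) (hper : ∀ x, f (x + 1) = f x)
    (hs : Summable (fcoeff f)) (x : ℝ) : HasSum (fun k => fcoeff f k * fmode k x) (f x) := by
  have hp : Function.Periodic f 1 := hper
  have hcont : Continuous (hp.lift : AddCircle (1 : ℝ) → ℂ) :=
    continuous_quot_lift _ hf
  let F : C(AddCircle (1 : ℝ), ℂ) := ⟨hp.lift, hcont⟩
  have hmode (k : ℤ) (y : ℝ) : fourier (T := 1) k (y : AddCircle (1 : ℝ)) = fmode k y := by
    rw [fourier_coe_apply, fmode]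
    congr 1
    push_cast
    ring
  have hco : fourierCoeff F = fcoeff f := by
    ext k
    rw [fourierCoeff_eq_intervalIntegral _ _ 0, fcoeff_eq]
    simp only [hmode, zero_add, div_one, one_smul, smul_eq_mul]
    rfl
  have h := has_pointwise_sum_fourier_series_of_summable (f := F) (by rwa [hco]) x
  simp only [hco, hmode, smul_eq_mul] at h
  exact h

/-- Integrating an absolutely convergent Fourier series against `conj g` term by term. -/
lemma hasSum_integral_mul_conj {ι : Type*} [Countable ι] {a : ι → ℂ} {n : ι → ℤ} {f g : ℝ → ℂ}
    (ha : Summable a) (hg : Continuous g)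
    (hf : ∀ x, HasSum (fun i => a i * fmode (n i) x) (f x)) :
    HasSum (fun i => a i * conj (fcoeff g (n i))) (∫ x in (0 : ℝ)..1, f x * conj (g x)) := by
  have hgc : Continuous fun x => conj (g x) := Complex.continuous_conj.comp hg
  have h := intervalIntegral.hasSum_integral_of_dominated_convergence (a := 0) (b := 1)
    (μ := volume) (F := fun i x => a i * fmode (n i) x * conj (g x))
    (f := fun x => f x * conj (g x)) (fun i x => ‖a i‖ * ‖g x‖)
    (fun i => (((continuous_fmode (n i)).const_mul _).mul hgc).aestronglyMeasurable)
    (fun i => .of_forall fun x _ => by simp [norm_fmode])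
    (.of_forall fun x _ => ha.norm.mul_right _)
    (by simp only [tsum_mul_right]; exact (hg.norm.const_mul _).intervalIntegrable _ _)
    (.of_forall fun x _ => (hf x).mul_right _)
  have hterm (i : ι) : a i * conj (fcoeff g (n i))
      = ∫ x in (0 : ℝ)..1, a i * fmode (n i) x * conj (g x) := by
    simp only [fcoeff_eq, ← intervalIntegral.intervalIntegral_conj, mul_assoc, intervalIntegral.integral_const_mul,
      map_mul, conj_fmode, neg_neg]
  simpa only [hterm] using h

/-- `C₊` is invisible when paired with a function all of whose frequencies are nonnegative. -/
lemma integral_CplusCircle_mul_conj {f g : ℝ → ℂ} (hf : ContDiff ℝ 2 f)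
    (hper : ∀ x, f (x + 1) = f x) (hg : Continuous g) (hg0 : ∀ k : ℤ, k < 0 → fcoeff g k = 0) :
    ∫ x in (0 : ℝ)..1, CplusCircle f x * conj (g x) = ∫ x in (0 : ℝ)..1, f x * conj (g x) := by
  have hs := summable_fcoeff hf hper
  have hsN : Summable fun k : ℕ => fcoeff f k := hs.comp_injective (i := fun k : ℕ => (k : ℤ)) Nat.cast_injective
  have h1 := hasSum_integral_mul_conj hs hg (hasSum_fcoeff_mul_fmode hf.continuous hper hs)
  have h2 : HasSum (fun k : ℕ => fcoeff f k * conj (fcoeff g k))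
      (∫ x in (0 : ℝ)..1, CplusCircle f x * conj (g x)) := by
    refine hasSum_integral_mul_conj (n := fun k : ℕ => (k : ℤ)) hsN hg fun x => ?_
    have hx : Summable fun k : ℕ => fcoeff f k * fmode k x :=
      .of_norm (by simpa [norm_fmode] using hsN.norm)
    have hC : CplusCircle f x = ∑' k : ℕ, fcoeff f k * fmode k x := by
      simp [CplusCircle, fmode]
    rw [hC]
    exact hx.hasSum
  have hinj : Function.Injective fun k : ℕ => (k : ℤ) := Nat.cast_injective
  refine h2.unique ((hinj.hasSum_iff fun k hk => ?_).2 h1)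
  have hk0 : k < 0 := by
    by_contra! h
    exact hk ⟨k.toNat, Int.toNat_of_nonneg h⟩
  simp [hg0 k hk0]

lemma fcoeff_const_of_ne_zero (c : ℂ) {k : ℤ} (hk : k ≠ 0) : fcoeff (fun _ => c) k = 0 := by
  have h := fcoeff_deriv (f := fun _ => c) contDiff_const (fun _ => rfl) k
  have h0 : fcoeff (deriv fun _ : ℝ => c) k = 0 := by simp [fcoeff]
  rw [h0] at h
  simpa [hk, Real.pi_ne_zero] using h.symm

lemma integral_deriv_eq_zero {f : ℝ → ℂ} (hf : ContDiff ℝ 1 f) (hper : ∀ x, f (x + 1) = f x) :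
    ∫ x in (0 : ℝ)..1, deriv f x = 0 := by
  rw [intervalIntegral.integral_deriv_eq_sub
    (fun x _ => hf.differentiable one_ne_zero x)
    ((hf.continuous_deriv le_rfl).intervalIntegrable _ _), sub_eq_zero]
  simpa using hper 0

/-- For a periodic `f`, the integral of `f' conj f` is purely imaginary. -/
lemma integral_deriv_mul_conj_add_conj {f : ℝ → ℂ} (hf : ContDiff ℝ 1 f)
    (hper : ∀ x, f (x + 1) = f x) :
    (∫ x in (0 : ℝ)..1, deriv f x * conj (f x)) + conj (∫ x in (0 : ℝ)..1, deriv f x * conj (f x))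
      = 0 := by
  have hfc : ContDiff ℝ 1 fun x => conj (f x) := Complex.conjCLE.contDiff.comp hf
  have hc : Continuous fun x => deriv f x * conj (f x) :=
    (hf.continuous_deriv le_rfl).mul hfc.continuous
  have hcc : Continuous fun x => conj (deriv f x * conj (f x)) := Complex.continuous_conj.comp hc
  rw [← intervalIntegral.intervalIntegral_conj, ← intervalIntegral.integral_add (hc.intervalIntegrable _ _)
    (hcc.intervalIntegrable _ _),
    ← integral_deriv_eq_zero (f := fun x => f x * conj (f x)) (hf.mul hfc) (by simp [hper])]
  congr 1
  ext x
  have hd := (hf.differentiable one_ne_zero x).hasDerivAt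
  have hdc : HasDerivAt (fun x => conj (f x)) (conj (deriv f x)) x :=
    Complex.conjCLE.hasFDerivAt.comp_hasDerivAt x hd
  rw [(hd.fun_mul hdc).deriv]
  simp [mul_comm]

/-- On the circle, the gauge `m` satisfies
`κ ∫₀¹ m = ∫₀¹ q m + ∫₀¹ q` and `∫₀¹ m` is real (equals `∫₀¹ conj m`). -/
theorem stmt12 (q m : ℝ → ℂ) (κ : ℝ) (hκ : 0 < κ)
    (hqs : ContDiff ℝ (⊤ : ℕ∞) q) (hqper : ∀ x : ℝ, q (x + 1) = q x) (hqreal : ∀ x : ℝ, (q x).im = 0)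
    (hms : ContDiff ℝ (⊤ : ℕ∞) m) (hmper : ∀ x : ℝ, m (x + 1) = m x)
    (hmsupp : ∀ k : ℤ, k < 0 → fcoeff m k = 0)
    (hgauge : ∀ x : ℝ, deriv m x
      = -Complex.I * κ * m x + Complex.I * CplusCircle (fun y => q y * (m y + 1)) x) :
    (κ : ℂ) * (∫ x in (0 : ℝ)..1, m x)
        = (∫ x in (0 : ℝ)..1, q x * m x) + (∫ x in (0 : ℝ)..1, q x) ∧
      (∫ x in (0 : ℝ)..1, m x) = (∫ x in (0 : ℝ)..1, conj (m x)) := by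
  have hq1 : ContDiff ℝ 2 q := contDiff_infty.1 hqs 2
  have hm2 : ContDiff ℝ 2 m := contDiff_infty.1 hms 2
  have hm1 : ContDiff ℝ 1 m := hm2.of_le (by norm_num)
  have hF : ContDiff ℝ 2 fun y => q y * (m y + 1) := hq1.mul (hm2.add contDiff_const)
  have hFper : ∀ x, q (x + 1) * (m (x + 1) + 1) = q x * (m x + 1) := by simp [hqper, hmper]
  have hmc := hm2.continuous
  have hqc := hq1.continuous
  have hmcc : Continuous fun x => conj (m x) := Complex.continuous_conj.comp hmc
  have hdc : Continuous (deriv m) := hm1.continuous_deriv le_rfl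
  have key (g : ℝ → ℂ) (hg : Continuous g) (hg0 : ∀ k : ℤ, k < 0 → fcoeff g k = 0) :
      ∫ x in (0 : ℝ)..1, deriv m x * conj (g x)
        = -Complex.I * κ * (∫ x in (0 : ℝ)..1, m x * conj (g x))
          + Complex.I * ∫ x in (0 : ℝ)..1, q x * (m x + 1) * conj (g x) := by
    have hgc : Continuous fun x => conj (g x) := Complex.continuous_conj.comp hg
    rw [← integral_CplusCircle_mul_conj hF hFper hg hg0, ← intervalIntegral.integral_const_mul,
      ← intervalIntegral.integral_const_mul, ← sub_eq_iff_eq_add',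
      ← intervalIntegral.integral_sub ((hdc.fun_mul hgc).intervalIntegrable _ _)
        (((hmc.fun_mul hgc).const_mul _).intervalIntegrable _ _)]
    congr 1
    ext x
    rw [hgauge x]
    ring
  have hmean : (κ : ℂ) * (∫ x in (0 : ℝ)..1, m x)
      = (∫ x in (0 : ℝ)..1, q x * m x) + ∫ x in (0 : ℝ)..1, q x := by
    have h := key (fun _ => 1) continuous_const fun k hk => fcoeff_const_of_ne_zero 1 hk.ne
    simp only [map_one, mul_one, integral_deriv_eq_zero hm1 hmper, mul_add] at h
    rw [intervalIntegral.integral_add ((hqc.fun_mul hmc).intervalIntegrable _ _)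
      (hqc.intervalIntegrable _ _)] at h
    linear_combination -Complex.I * h
      + ((κ : ℂ) * (∫ x in (0 : ℝ)..1, m x) - ((∫ x in (0 : ℝ)..1, q x * m x)
        + ∫ x in (0 : ℝ)..1, q x)) * Complex.I_sq
  refine ⟨hmean, ?_⟩
  have hqconj (x : ℝ) : conj (q x) = q x := Complex.conj_eq_iff_im.2 (hqreal x)
  have hmm : conj (∫ x in (0 : ℝ)..1, m x * conj (m x)) = ∫ x in (0 : ℝ)..1, m x * conj (m x) := by
    rw [← intervalIntegral.intervalIntegral_conj]
    simp [mul_comm]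
  have hqmm : conj (∫ x in (0 : ℝ)..1, q x * m x * conj (m x))
      = ∫ x in (0 : ℝ)..1, q x * m x * conj (m x) := by
    rw [← intervalIntegral.intervalIntegral_conj]
    congr 1
    ext x
    simp only [map_mul, hqconj, Complex.conj_conj]
    ring
  have hq : conj (∫ x in (0 : ℝ)..1, q x) = ∫ x in (0 : ℝ)..1, q x := by
    rw [← intervalIntegral.intervalIntegral_conj]
    simp [hqconj]
  have hqm : conj (∫ x in (0 : ℝ)..1, q x * m x) = ∫ x in (0 : ℝ)..1, q x * conj (m x) := by
    rw [← intervalIntegral.intervalIntegral_conj]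
    simp [hqconj]
  have hqm_real : conj (∫ x in (0 : ℝ)..1, q x * m x) = ∫ x in (0 : ℝ)..1, q x * m x := by
    have h := key m hmc hmsupp
    have him := integral_deriv_mul_conj_add_conj hm1 hmper
    simp only [mul_add, add_mul, mul_one] at h
    rw [intervalIntegral.integral_add (((hqc.fun_mul hmc).fun_mul hmcc).intervalIntegrable _ _)
      ((hqc.fun_mul hmcc).intervalIntegrable _ _), ← hqm] at h
    rw [h] at him
    simp only [map_add, map_mul, map_neg, Complex.conj_I, Complex.conj_ofReal, hmm, hqmm,
      Complex.conj_conj] at him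
    linear_combination -Complex.I * him
      + (conj (∫ x in (0 : ℝ)..1, q x * m x) - ∫ x in (0 : ℝ)..1, q x * m x) * Complex.I_sq
  have hκ' : (κ : ℂ) ≠ 0 := by exact_mod_cast hκ.ne'
  refine mul_left_cancel₀ hκ' ?_
  have h := congrArg conj hmean
  rw [map_mul, map_add, Complex.conj_ofReal, hqm_real, hq, ← hmean] at h
  rw [intervalIntegral.intervalIntegral_conj, h]
end

section
/- Let σ ∈ (1/2, 1) and let u : ℝ → ℝ be a continuous function in H^σ(ℝ) (i.e., ∫_ℝ (|ξ|+1)^{2σ} |û(ξ)|² dξ < ∞) satisfying inf_{x ∈ ℝ} (1 + u(x)) > 0. Then there exists μ ∈ H^σ(ℝ), complex-valued with Fourier transform supported in [0,∞), such that (1 + μ(x)) (1 + conj(μ)(x)) = 1 + u(x) for all x ∈ ℝ. (This is the Wiener–Hopf factorization used in the analysis of the Bock–Kruskal transformation.) -/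
open MeasureTheory Set ComplexConjugate
open scoped ENNReal

/-- Inverse Fourier transform with the convention `f(x) = (2π)^{-1/2} ∫ e^{iξx} F(ξ) dξ`. -/
noncomputable def IFT (F : ℝ → ℂ) (x : ℝ) : ℂ :=
  (Real.sqrt (2 * Real.pi))⁻¹ * ∫ ξ : ℝ, Complex.exp (Complex.I * ξ * x) * F ξ

open scoped FourierTransform SchwartzMap ContDiff

/-- The inverse Fourier transform is self-adjoint for the bilinear pairing on `L¹`. -/
lemma integral_fourierInv_mul_eq_flip {f g : ℝ → ℂ} (hf : Integrable f) (hg : Integrable g) :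
    ∫ x, 𝓕⁻ f x * g x = ∫ x, f x * 𝓕⁻ g x := by
  have := VectorFourier.integral_fourierIntegral_smul_eq_flip (μ := volume) (ν := volume)
    (L := -innerₗ ℝ) Real.continuous_fourierChar (by fun_prop) hf hg
  simp only [smul_eq_mul] at this
  convert! this using 4 with x x
  simp only [VectorFourier.fourierIntegral, Real.fourierInv_eq, LinearMap.flip_apply]
  congr 1 with v
  simp [mul_comm]

lemma integral_mul_Lp_fourierInv (φ : 𝓢(ℝ, ℂ)) (G : Lp (α := ℝ) ℂ 2) :
    ∫ x, φ x * (𝓕⁻ G : Lp (α := ℝ) ℂ 2) x = ∫ ξ, 𝓕⁻ (φ : ℝ → ℂ) ξ * G ξ := by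
  have h := congrArg (fun T : 𝓢'(ℝ, ℂ) => T φ) (Lp.fourierInv_toTemperedDistribution_eq G)
  simp only [TemperedDistribution.fourierInv_apply, Lp.toTemperedDistribution_apply,
    smul_eq_mul] at h
  rw [← h, SchwartzMap.fourierInv_coe]

lemma ae_eq_of_integral_schwartz_mul {f g : ℝ → ℂ} (hf : LocallyIntegrable f)
    (hg : LocallyIntegrable g)
    (h : ∀ φ : 𝓢(ℝ, ℂ), HasCompactSupport φ → ∫ x, φ x * f x = ∫ x, φ x * g x) :
    f =ᵐ[volume] g := by
  refine ae_eq_of_integral_contDiff_smul_eq hf hg fun φ hφ hc => ?_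
  have hc' : HasCompactSupport (Complex.ofRealCLM ∘ φ) := hc.comp_left rfl
  have hφ' : ContDiff ℝ ∞ (Complex.ofRealCLM ∘ φ) := by fun_prop
  simpa using h (hc'.toSchwartzMap hφ') (by exact hc')

lemma continuous_fourierInv {F : ℝ → ℂ} (hF : Integrable F) : Continuous (𝓕⁻ F) := by
  rw [← Real.Lp.fourierTransformInv_toLp (memLp_one_iff_integrable.2 hF)]
  exact BoundedContinuousFunction.continuous _

/-- On `L¹ ∩ L²` the `L²` inverse Fourier transform is given by the integral formula. -/
lemma Lp_fourierInv_toLp_ae_eq {F : ℝ → ℂ} (h1 : Integrable F) (h2 : MemLp F 2) :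
    ((𝓕⁻ (h2.toLp F) : Lp (α := ℝ) ℂ 2) : ℝ → ℂ) =ᵐ[volume] 𝓕⁻ F := by
  refine ae_eq_of_integral_schwartz_mul ((Lp.memLp _).locallyIntegrable (by norm_num)) ?_ ?_
  · exact (continuous_fourierInv h1).locallyIntegrable
  · intro φ _
    rw [integral_mul_Lp_fourierInv, ← integral_fourierInv_mul_eq_flip φ.integrable h1]
    refine integral_congr_ae ?_
    filter_upwards [h2.coeFn_toLp] with x hx
    rw [hx]

lemma fourierInv_comp_sub (φ : ℝ → ℂ) (y ξ : ℝ) :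
    𝓕⁻ (fun x => φ (x - y)) ξ = ((Real.fourierChar (y * ξ) : Circle) : ℂ) * 𝓕⁻ φ ξ := by
  rw [Real.fourierInv_eq, Real.fourierInv_eq, ← integral_const_mul,
    ← integral_sub_right_eq_self
      (fun x => (((Real.fourierChar (y * ξ) : Circle)) : ℂ) * (Real.fourierChar (inner ℝ x ξ) • φ x)) y]
  congr 1 with x
  have : (inner ℝ x ξ : ℝ) = y * ξ + inner ℝ (x - y) ξ := by simp; ring
  rw [this, AddChar.map_add_eq_mul]
  simp [Circle.smul_def, mul_assoc]

/-- Translation becomes multiplication by a character under the Fourier transform. -/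
lemma Lp_fourierInv_translate_sub (G : Lp (α := ℝ) ℂ 2) (y : ℝ)
    (hm : MemLp (fun ξ => (((Real.fourierChar (y * ξ) : Circle) : ℂ) - 1) * G ξ) 2) :
    ((𝓕⁻ (hm.toLp _) : Lp (α := ℝ) ℂ 2) : ℝ → ℂ) =ᵐ[volume]
      fun x => (𝓕⁻ G : Lp (α := ℝ) ℂ 2) (x + y) - (𝓕⁻ G : Lp (α := ℝ) ℂ 2) x := by
  set g : ℝ → ℂ := ((𝓕⁻ G : Lp (α := ℝ) ℂ 2 volume) : ℝ → ℂ) with hg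
  have hg2 : MemLp g 2 := Lp.memLp _
  have hgy : MemLp (fun x => g (x + y)) 2 :=
    hg2.comp_measurePreserving (measurePreserving_add_right volume y)
  refine ae_eq_of_integral_schwartz_mul ((Lp.memLp _).locallyIntegrable (by norm_num))
    ((hgy.sub hg2).locallyIntegrable (by norm_num)) fun φ hc => ?_
  have hφy : ContDiff ℝ ∞ (fun x => φ (x - y)) := by
    have := φ.smooth'
    fun_prop
  have hcy : HasCompactSupport (fun x => φ (x - y)) :=
    hc.comp_homeomorph (Homeomorph.subRight y)
  have key := integral_mul_Lp_fourierInv (hcy.toSchwartzMap hφy) G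
  have key0 := integral_mul_Lp_fourierInv φ G
  rw [integral_mul_Lp_fourierInv]
  rw [← hg] at key key0
  have e1 : ∫ ξ, 𝓕⁻ (φ : ℝ → ℂ) ξ * hm.toLp _ ξ
      = ∫ ξ, (𝓕⁻ (fun x => φ (x - y)) ξ * G ξ - 𝓕⁻ (φ : ℝ → ℂ) ξ * G ξ) := by
    refine integral_congr_ae ?_
    filter_upwards [hm.coeFn_toLp] with ξ hξ
    rw [hξ, fourierInv_comp_sub]
    ring
  have int1 : ∀ (ψ : 𝓢(ℝ, ℂ)) (k : ℝ → ℂ), MemLp k 2 → Integrable (fun ξ => ψ ξ * k ξ) :=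
    fun ψ k hk => (ψ.memLp 2 volume).integrable_mul hk
  have i1 : Integrable (fun ξ => 𝓕⁻ (fun x => φ (x - y)) ξ * G ξ) := by
    have := int1 (𝓕⁻ (hcy.toSchwartzMap hφy)) G (Lp.memLp G)
    rwa [SchwartzMap.fourierInv_coe] at this
  have i2 : Integrable (fun ξ => 𝓕⁻ (φ : ℝ → ℂ) ξ * G ξ) := by
    have := int1 (𝓕⁻ φ) G (Lp.memLp G)
    rwa [SchwartzMap.fourierInv_coe] at this
  rw [e1, integral_sub i1 i2, ← key0]
  have key' : ∫ ξ, 𝓕⁻ (fun x => φ (x - y)) ξ * G ξ = ∫ x, φ (x - y) * g x := key.symm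
  rw [key', ← integral_add_right_eq_self _ y]
  simp only [add_sub_cancel_right, mul_sub]
  exact (integral_sub (int1 φ _ hgy) (int1 φ _ hg2)).symm

lemma lintegral_enorm_sq_Lp_fourierInv (G : Lp (α := ℝ) ℂ 2) :
    ∫⁻ x, ‖(𝓕⁻ G : Lp (α := ℝ) ℂ 2) x‖ₑ ^ 2 = ∫⁻ ξ, ‖G ξ‖ₑ ^ 2 := by
  have h : ‖(𝓕⁻ G : Lp (α := ℝ) ℂ 2 volume)‖ = ‖G‖ := by
    rw [← Lp.norm_fourier_eq (𝓕⁻ G), FourierTransform.fourier_fourierInv_eq]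
  have h' : ∀ H : Lp (α := ℝ) ℂ 2, ∫⁻ x, ‖H x‖ₑ ^ 2 = ‖H‖ₑ ^ 2 := by
    intro H
    rw [Lp.enorm_def, eLpNorm_eq_lintegral_rpow_enorm_toReal (by norm_num) (by norm_num)]
    simp only [ENNReal.toReal_ofNat, ENNReal.rpow_ofNat]
    rw [← ENNReal.rpow_natCast, ← ENNReal.rpow_mul]
    norm_num
  rw [h', h', enorm_eq_iff_norm_eq.2 h]

/-- Plancherel's identity for differences of translates. -/
lemma lintegral_enorm_sq_translate_sub (G : Lp (α := ℝ) ℂ 2) (y : ℝ) :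
    ∫⁻ x, ‖(𝓕⁻ G : Lp (α := ℝ) ℂ 2) (x + y) - (𝓕⁻ G : Lp (α := ℝ) ℂ 2) x‖ₑ ^ 2
      = ∫⁻ ξ, ‖((Real.fourierChar (y * ξ) : Circle) : ℂ) - 1‖ₑ ^ 2 * ‖G ξ‖ₑ ^ 2 := by
  have hm : MemLp (fun ξ => (((Real.fourierChar (y * ξ) : Circle) : ℂ) - 1) * G ξ) 2 := by
    refine (Lp.memLp G).of_le_mul (c := 2) ?_ (Filter.Eventually.of_forall fun ξ => ?_)
    · have : Continuous fun ξ : ℝ => ((Real.fourierChar (y * ξ) : Circle) : ℂ) - 1 := by fun_prop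
      exact this.aestronglyMeasurable.mul (Lp.aestronglyMeasurable G)
    · rw [norm_mul]
      gcongr
      refine (norm_sub_le _ _).trans ?_
      rw [Circle.norm_coe, norm_one]
      norm_num
  have h := lintegral_enorm_sq_Lp_fourierInv (hm.toLp _)
  have h' := lintegral_congr_ae
    ((Lp_fourierInv_translate_sub G y hm).fun_comp (fun z => ‖z‖ₑ ^ 2))
  simp only [Function.comp_def] at h'
  rw [← h', h]
  refine lintegral_congr_ae ?_
  filter_upwards [hm.coeFn_toLp] with ξ hξ
  rw [hξ, enorm_mul, mul_pow]

lemma norm_fourierChar_sub_one_le (t : ℝ) :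
    ‖((Real.fourierChar t : Circle) : ℂ) - 1‖ ≤ 2 * Real.pi * |t| := by
  have h := Real.norm_exp_I_mul_ofReal_sub_one_le (x := 2 * Real.pi * t)
  rw [Real.fourierChar_apply, mul_comm _ Complex.I]
  refine h.trans_eq ?_
  rw [Real.norm_eq_abs, abs_mul, abs_of_pos Real.two_pi_pos]

lemma norm_fourierChar_sub_one_le_two (t : ℝ) :
    ‖((Real.fourierChar t : Circle) : ℂ) - 1‖ ≤ 2 := by
  refine (norm_sub_le _ _).trans ?_
  rw [Circle.norm_coe, norm_one]
  norm_num

lemma integrable_fourierChar_sub_one_sq_mul_rpow {σ : ℝ} (hσ : σ ∈ Ioo (0 : ℝ) 1) :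
    Integrable fun t : ℝ =>
      ‖((Real.fourierChar t : Circle) : ℂ) - 1‖ ^ 2 * |t| ^ (-(1 + 2 * σ)) := by
  set k := fun t : ℝ =>
      ‖((Real.fourierChar t : Circle) : ℂ) - 1‖ ^ 2 * |t| ^ (-(1 + 2 * σ)) with hk
  have hmeas : AEStronglyMeasurable k := by
    refine Measurable.aestronglyMeasurable ?_
    have : Measurable fun t : ℝ => ((Real.fourierChar t : Circle) : ℂ) := by
      have : Continuous fun t : ℝ => ((Real.fourierChar t : Circle) : ℂ) := by fun_prop
      exact this.measurable
    fun_prop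
  have heven : ∀ t, k (-t) = k t := fun t => by
    have : ((Real.fourierChar (-t) : Circle) : ℂ) - 1 =
        conj (((Real.fourierChar t : Circle) : ℂ) - 1) := by
      rw [AddChar.map_neg_eq_inv, Circle.coe_inv_eq_conj, map_sub, map_one]
    simp only [hk, this, RCLike.norm_conj, abs_neg]
  have h1 : IntegrableOn k (Ioo 0 1) := by
    have h := ((intervalIntegral.integrableOn_Ioo_rpow_iff (s := 1 - 2 * σ) one_pos).2
      (by linarith [hσ.2])).const_mul ((2 * Real.pi) ^ 2)
    refine h.mono' hmeas.restrict ?_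
    filter_upwards [self_mem_ae_restrict measurableSet_Ioo] with t ht
    rw [Real.norm_of_nonneg (by positivity)]
    have e : t ^ (1 - 2 * σ) = t ^ 2 * t ^ (-(1 + 2 * σ)) := by
      rw [← Real.rpow_natCast, ← Real.rpow_add ht.1]
      norm_num
      ring_nf
    rw [e, ← mul_assoc, ← mul_pow]
    simp only [hk]
    have := norm_fourierChar_sub_one_le t
    rw [abs_of_pos ht.1] at *
    gcongr
    exact Real.rpow_nonneg ht.1.le _
  have h2 : IntegrableOn k (Ioi 1) := by
    have h := (integrableOn_Ioi_rpow_of_lt (a := -(1 + 2 * σ)) (by linarith [hσ.1])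
      one_pos).const_mul (2 ^ 2)
    refine h.mono' hmeas.restrict ?_
    filter_upwards [self_mem_ae_restrict measurableSet_Ioi] with t ht
    have ht0 : 0 < t := one_pos.trans ht
    rw [Real.norm_of_nonneg (by positivity)]
    simp only [hk]
    have := norm_fourierChar_sub_one_le_two t
    rw [abs_of_pos ht0]
    gcongr
  have h3 : IntegrableOn k (Ici 0) := by
    rw [integrableOn_Ici_iff_integrableOn_Ioi, ← Ioc_union_Ioi_eq_Ioi zero_le_one]
    exact ((integrableOn_Ioc_iff_integrableOn_Ioo (by simp)).2 h1).union h2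
  have h4 : IntegrableOn k (Iic 0) := by
    have := IntegrableOn.comp_neg_Iic (c := (0 : ℝ)) (f := k) (by simpa using h3)
    simpa only [heven] using this
  rw [← integrableOn_univ, ← Iic_union_Ici (a := (0 : ℝ))]
  exact h4.union h3

lemma lintegral_comp_mul_right_real (f : ℝ → ℝ≥0∞) {a : ℝ} (ha : a ≠ 0) :
    ∫⁻ y, f (y * a) = ENNReal.ofReal |a⁻¹| * ∫⁻ y, f y := by
  have h : ∫⁻ y, f (y * a) = ∫⁻ y, f y ∂(Measure.map (· * a) volume) :=
    (lintegral_map_equiv f (Homeomorph.mulRight₀ a ha).toMeasurableEquiv).symm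
  rw [h, Real.map_volume_mul_right ha, lintegral_smul_measure, smul_eq_mul]

lemma exists_fractional_kernel_constant {σ : ℝ} (hσ : σ ∈ Ioo (0 : ℝ) 1) :
    ∃ c : ℝ≥0∞, c ≠ 0 ∧ c ≠ ⊤ ∧ ∀ ξ : ℝ,
      ∫⁻ y : ℝ, ‖((Real.fourierChar (y * ξ) : Circle) : ℂ) - 1‖ₑ ^ 2 *
        ENNReal.ofReal (|y| ^ (-(1 + 2 * σ))) = c * ENNReal.ofReal (|ξ| ^ (2 * σ)) := by
  have hmeas : Measurable fun t : ℝ => ((Real.fourierChar t : Circle) : ℂ) := by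
    have : Continuous fun t : ℝ => ((Real.fourierChar t : Circle) : ℂ) := by fun_prop
    exact this.measurable
  set κ := fun t : ℝ => ‖((Real.fourierChar t : Circle) : ℂ) - 1‖ₑ ^ 2 *
        ENNReal.ofReal (|t| ^ (-(1 + 2 * σ))) with hκ
  refine ⟨∫⁻ t, κ t, ?_, ?_, fun ξ => ?_⟩
  · rw [Ne, lintegral_eq_zero_iff (by fun_prop)]
    intro h
    have h' : volume (Ioo (0 : ℝ) 1) ≤ 0 := by
      rw [← ae_iff.1 h]
      refine measure_mono fun t ht => ?_
      simp only [mem_ofPred_eq, hκ, Pi.zero_apply, mul_eq_zero, not_or]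
      constructor
      · simp only [ne_eq, OfNat.ofNat_ne_zero, not_false_eq_true, pow_eq_zero_iff, enorm_eq_zero,
          sub_eq_zero]
        rw [Real.fourierChar_apply, Complex.exp_eq_one_iff]
        rintro ⟨n, hn⟩
        have hpi : (2 * Real.pi * Complex.I : ℂ) ≠ 0 := Complex.two_pi_I_ne_zero
        have : (t : ℂ) = n := by
          apply mul_right_cancel₀ hpi
          rw [← hn]; push_cast; ring
        have : t = n := by exact_mod_cast this
        have h1 : (0 : ℝ) < n := this ▸ ht.1
        have h2 : (n : ℝ) < 1 := this ▸ ht.2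
        norm_cast at h1 h2
        omega
      · have := Real.rpow_pos_of_pos (abs_pos.2 ht.1.ne') (-(1 + 2 * σ))
        simpa using this
    simp at h'
  · have h := (integrable_fourierChar_sub_one_sq_mul_rpow hσ).lintegral_lt_top
    refine ne_of_lt (lt_of_eq_of_lt (lintegral_congr fun t => ?_) h)
    rw [ENNReal.ofReal_mul (by positivity), ENNReal.ofReal_pow (norm_nonneg _), ofReal_norm]
  · rcases eq_or_ne ξ 0 with rfl | hξ
    · have : 2 * σ ≠ 0 := by linarith [hσ.1]
      simp [Real.zero_rpow this]
    · have hξ' := abs_pos.2 hξ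
      have e : ∀ y : ℝ, ‖((Real.fourierChar (y * ξ) : Circle) : ℂ) - 1‖ₑ ^ 2 *
          ENNReal.ofReal (|y| ^ (-(1 + 2 * σ))) =
          ENNReal.ofReal (|ξ| ^ (1 + 2 * σ)) * κ (y * ξ) := by
        intro y
        have : |y| ^ (-(1 + 2 * σ)) = |ξ| ^ (1 + 2 * σ) * |y * ξ| ^ (-(1 + 2 * σ)) := by
          rw [abs_mul, Real.mul_rpow (abs_nonneg _) (abs_nonneg _), Real.rpow_neg hξ'.le]
          field_simp
        rw [this, ENNReal.ofReal_mul (by positivity)]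
        ring
      simp_rw [e]
      rw [lintegral_const_mul _ (by fun_prop), lintegral_comp_mul_right_real _ hξ, ← mul_assoc,
        ← ENNReal.ofReal_mul (by positivity), mul_comm]
      congr 2
      rw [abs_inv, Real.rpow_add hξ', Real.rpow_one]
      field_simp

lemma lintegral_gagliardo_eq {σ : ℝ} {c : ℝ≥0∞} (hc : ∀ ξ : ℝ,
      ∫⁻ y : ℝ, ‖((Real.fourierChar (y * ξ) : Circle) : ℂ) - 1‖ₑ ^ 2 *
        ENNReal.ofReal (|y| ^ (-(1 + 2 * σ))) = c * ENNReal.ofReal (|ξ| ^ (2 * σ)))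
    (G : Lp (α := ℝ) ℂ 2 volume) :
    ∫⁻ y : ℝ, (∫⁻ x, ‖(𝓕⁻ G : Lp (α := ℝ) ℂ 2 volume) (x + y) - (𝓕⁻ G : Lp (α := ℝ) ℂ 2 volume) x‖ₑ ^ 2) *
        ENNReal.ofReal (|y| ^ (-(1 + 2 * σ)))
      = c * ∫⁻ ξ, ENNReal.ofReal (|ξ| ^ (2 * σ)) * ‖G ξ‖ₑ ^ 2 := by
  have hmeas : Measurable fun t : ℝ => ((Real.fourierChar t : Circle) : ℂ) := by
    have : Continuous fun t : ℝ => ((Real.fourierChar t : Circle) : ℂ) := by fun_prop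
    exact this.measurable
  have hG : Measurable G := (Lp.stronglyMeasurable G).measurable
  calc _ = ∫⁻ y : ℝ, ∫⁻ ξ, ‖((Real.fourierChar (y * ξ) : Circle) : ℂ) - 1‖ₑ ^ 2 *
        ENNReal.ofReal (|y| ^ (-(1 + 2 * σ))) * ‖G ξ‖ₑ ^ 2 := by
        refine lintegral_congr fun y => ?_
        rw [lintegral_enorm_sq_translate_sub, ← lintegral_mul_const _ (by fun_prop)]
        exact lintegral_congr fun ξ => by ring
    _ = ∫⁻ ξ, ∫⁻ y : ℝ, ‖((Real.fourierChar (y * ξ) : Circle) : ℂ) - 1‖ₑ ^ 2 *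
        ENNReal.ofReal (|y| ^ (-(1 + 2 * σ))) * ‖G ξ‖ₑ ^ 2 := by
        rw [lintegral_lintegral_swap]
        exact Measurable.aemeasurable (by fun_prop)
    _ = ∫⁻ ξ, c * (ENNReal.ofReal (|ξ| ^ (2 * σ)) * ‖G ξ‖ₑ ^ 2) := by
        refine lintegral_congr fun ξ => ?_
        rw [lintegral_mul_const _ (by fun_prop), hc, mul_assoc]
    _ = _ := lintegral_const_mul _ (by fun_prop)

/-- The square of the `H^σ` norm of the function with Fourier transform `F`. -/
noncomputable def sobolevWeight (σ : ℝ) (F : ℝ → ℂ) : ℝ≥0∞ :=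
  ∫⁻ ξ : ℝ, ENNReal.ofReal ((|ξ| + 1) ^ (2 * σ) * ‖F ξ‖ ^ 2)

lemma memLp_two_of_lintegral_lt_top {f : ℝ → ℂ} (hf : AEStronglyMeasurable f)
    (h : ∫⁻ x, ‖f x‖ₑ ^ 2 < ⊤) : MemLp f 2 := by
  refine ⟨hf, ?_⟩
  rw [eLpNorm_lt_top_iff_lintegral_rpow_enorm_lt_top (by norm_num) (by norm_num)]
  simpa using h

lemma MeasureTheory.MemLp.lintegral_enorm_sq_lt_top {f : ℝ → ℂ} (h : MemLp f 2) :
    ∫⁻ x, ‖f x‖ₑ ^ 2 < ⊤ := by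
  have := (eLpNorm_lt_top_iff_lintegral_rpow_enorm_lt_top (by norm_num) (by norm_num)).1 h.2
  simpa using this

lemma ofReal_mul_norm_sq {a : ℝ} (ha : 0 ≤ a) (z : ℂ) :
    ENNReal.ofReal (a * ‖z‖ ^ 2) = ENNReal.ofReal a * ‖z‖ₑ ^ 2 := by
  rw [ENNReal.ofReal_mul ha, ENNReal.ofReal_pow (norm_nonneg _), ofReal_norm]

section sobolevWeight

variable {σ : ℝ} {F : ℝ → ℂ}

lemma memLp_two_of_sobolevWeight (hσ : 0 ≤ σ) (hF : Measurable F) (h : sobolevWeight σ F < ⊤) :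
    MemLp F 2 := by
  refine memLp_two_of_lintegral_lt_top hF.aestronglyMeasurable (lt_of_le_of_lt ?_ h)
  refine lintegral_mono fun ξ => ?_
  rw [ofReal_mul_norm_sq (by positivity)]
  refine le_mul_of_one_le_left (by positivity) ?_
  rw [ENNReal.one_le_ofReal]
  exact Real.one_le_rpow (by linarith [abs_nonneg ξ]) (by linarith)

lemma integrable_of_sobolevWeight (hσ : 1 / 2 < σ) (hF : Measurable F)
    (h : sobolevWeight σ F < ⊤) : Integrable F := by
  have h1 : Integrable fun ξ : ℝ => (|ξ| + 1) ^ (2 * σ) * ‖F ξ‖ ^ 2 := by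
    refine ⟨by fun_prop, ?_⟩
    rw [hasFiniteIntegral_iff_ofReal (Filter.Eventually.of_forall fun ξ => by positivity)]
    exact h
  have h2 : Integrable fun ξ : ℝ => (1 + ‖ξ‖) ^ (-(2 * σ)) :=
    integrable_one_add_norm (by simp; linarith)
  refine (h1.add h2).mono' hF.aestronglyMeasurable (Filter.Eventually.of_forall fun ξ => ?_)
  have hw : 0 < (|ξ| + 1) ^ (2 * σ) := by positivity
  simp only [Pi.add_apply, Real.norm_eq_abs]
  rw [add_comm 1, Real.rpow_neg (by positivity)]
  set w := (|ξ| + 1) ^ (2 * σ)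
  have : ‖F ξ‖ * (2 * w) ≤ (w * ‖F ξ‖ ^ 2 + w⁻¹) * (2 * w) := by
    have : (w * ‖F ξ‖ ^ 2 + w⁻¹) * (2 * w) = 2 * (w * ‖F ξ‖) ^ 2 + 2 := by field_simp
    rw [this]
    nlinarith [sq_nonneg (w * ‖F ξ‖ - 1)]
  exact le_of_mul_le_mul_right this (by positivity)

lemma lintegral_homogeneous_lt_top (hσ : 0 ≤ σ) (h : sobolevWeight σ F < ⊤) :
    ∫⁻ ξ, ENNReal.ofReal (|ξ| ^ (2 * σ)) * ‖F ξ‖ₑ ^ 2 < ⊤ := by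
  refine lt_of_le_of_lt (lintegral_mono fun ξ => ?_) h
  rw [ofReal_mul_norm_sq (by positivity)]
  gcongr
  linarith

lemma sobolevWeight_lt_top (hσ : 0 ≤ σ) (hF : Measurable F) (h0 : MemLp F 2)
    (h : ∫⁻ ξ, ENNReal.ofReal (|ξ| ^ (2 * σ)) * ‖F ξ‖ₑ ^ 2 < ⊤) : sobolevWeight σ F < ⊤ := by
  have h' : ∫⁻ ξ, ENNReal.ofReal (2 ^ (2 * σ)) *
      (‖F ξ‖ₑ ^ 2 + ENNReal.ofReal (|ξ| ^ (2 * σ)) * ‖F ξ‖ₑ ^ 2) < ⊤ := by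
    rw [lintegral_const_mul _ (by fun_prop), lintegral_add_left (by fun_prop)]
    exact ENNReal.mul_lt_top ENNReal.ofReal_lt_top
      (ENNReal.add_lt_top.2 ⟨h0.lintegral_enorm_sq_lt_top, h⟩)
  refine lt_of_le_of_lt (lintegral_mono fun ξ => ?_) h'
  rw [ofReal_mul_norm_sq (by positivity), ← one_add_mul, ← mul_assoc]
  gcongr
  rw [← ENNReal.ofReal_one, ← ENNReal.ofReal_add zero_le_one (by positivity),
    ← ENNReal.ofReal_mul (by positivity)]
  refine ENNReal.ofReal_le_ofReal ?_
  have hpos : 0 ≤ |ξ| ^ (2 * σ) := by positivity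
  rcases le_total |ξ| 1 with hξ | hξ
  · calc (|ξ| + 1) ^ (2 * σ) ≤ 2 ^ (2 * σ) :=
        Real.rpow_le_rpow (by positivity) (by linarith) (by linarith)
      _ ≤ _ := le_mul_of_one_le_right (by positivity) (by linarith)
  · calc (|ξ| + 1) ^ (2 * σ) ≤ (2 * |ξ|) ^ (2 * σ) :=
        Real.rpow_le_rpow (by positivity) (by linarith) (by linarith)
      _ = 2 ^ (2 * σ) * |ξ| ^ (2 * σ) := Real.mul_rpow (by norm_num) (abs_nonneg _)
      _ ≤ _ := by gcongr; linarith

end sobolevWeight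

/-- Functions that are dominated, together with their increments, by an `H^σ` function are
in `H^σ`. -/
lemma exists_sobolev_of_dominated {σ : ℝ} (hσ : σ ∈ Ioo (1 / 2 : ℝ) 1) {F : ℝ → ℂ}
    (hF : Measurable F) (hw : sobolevWeight σ F < ⊤) {g : ℝ → ℂ} (hg : Continuous g) {C : ℝ}
    (hgC : ∀ x, ‖g x‖ ≤ C * ‖𝓕⁻ F x‖) (hgd : ∀ x y, ‖g x - g y‖ ≤ C * ‖𝓕⁻ F x - 𝓕⁻ F y‖) :
    ∃ G : ℝ → ℂ, Measurable G ∧ sobolevWeight σ G < ⊤ ∧ ∀ x, g x = 𝓕⁻ G x := by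
  have hσ0 : 0 ≤ σ := by linarith [hσ.1]
  obtain ⟨c, hc0, hct, hc⟩ := exists_fractional_kernel_constant (σ := σ) ⟨by linarith [hσ.1], hσ.2⟩
  have hF1 := integrable_of_sobolevWeight hσ.1 hF hw
  have hF2 := memLp_two_of_sobolevWeight hσ0 hF hw
  have hFae := Lp_fourierInv_toLp_ae_eq hF1 hF2
  have hf2 : MemLp (𝓕⁻ F) 2 := (memLp_congr_ae hFae).1 (Lp.memLp _)
  have hg2 : MemLp g 2 :=
    hf2.of_le_mul hg.aestronglyMeasurable (Filter.Eventually.of_forall hgC)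
  set G : Lp (α := ℝ) ℂ 2 volume := 𝓕 (hg2.toLp g) with hG
  have hGg : ((𝓕⁻ G : Lp (α := ℝ) ℂ 2 volume) : ℝ → ℂ) =ᵐ[volume] g := by
    rw [hG, FourierTransform.fourierInv_fourier_eq]
    exact hg2.coeFn_toLp
  have hGm : Measurable G := (Lp.stronglyMeasurable G).measurable
  have shift : ∀ (y : ℝ) {a b : ℝ → ℂ}, a =ᵐ[volume] b →
      (fun x => ‖a (x + y) - a x‖ₑ ^ 2) =ᵐ[volume] fun x => ‖b (x + y) - b x‖ₑ ^ 2 := by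
    intro y a b hab
    filter_upwards [hab, (measurePreserving_add_right volume y).quasiMeasurePreserving.ae hab]
      with x h1 h2
    rw [h1, h2]
  have gag := lintegral_gagliardo_eq hc G
  have gagF := lintegral_gagliardo_eq hc (hF2.toLp F)
  have hFhom : ∫⁻ ξ, ENNReal.ofReal (|ξ| ^ (2 * σ)) * ‖hF2.toLp F ξ‖ₑ ^ 2 < ⊤ := by
    refine lt_of_eq_of_lt (lintegral_congr_ae ?_) (lintegral_homogeneous_lt_top hσ0 hw)
    filter_upwards [hF2.coeFn_toLp] with ξ hξ
    rw [hξ]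
  have hle : c * ∫⁻ ξ, ENNReal.ofReal (|ξ| ^ (2 * σ)) * ‖G ξ‖ₑ ^ 2 ≤
      ENNReal.ofReal (C ^ 2) *
        (c * ∫⁻ ξ, ENNReal.ofReal (|ξ| ^ (2 * σ)) * ‖hF2.toLp F ξ‖ₑ ^ 2) := by
    rw [← gag, ← gagF, ← lintegral_const_mul' _ _ ENNReal.ofReal_ne_top]
    refine lintegral_mono fun y => ?_
    dsimp only
    rw [← mul_assoc, ← lintegral_const_mul' _ _ ENNReal.ofReal_ne_top,
      lintegral_congr_ae (shift y hGg)]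
    refine mul_le_mul_left ?_ _
    refine lintegral_mono_ae ?_
    filter_upwards [shift y hFae] with x hx
    rw [hx, ← ofReal_norm, ← ofReal_norm, ← ENNReal.ofReal_pow (norm_nonneg _),
      ← ENNReal.ofReal_pow (norm_nonneg _), ← ENNReal.ofReal_mul (by positivity), ← mul_pow]
    exact ENNReal.ofReal_le_ofReal (pow_le_pow_left₀ (norm_nonneg _) (hgd _ _) 2)
  have hGhom : ∫⁻ ξ, ENNReal.ofReal (|ξ| ^ (2 * σ)) * ‖G ξ‖ₑ ^ 2 < ⊤ := by
    have : c * ∫⁻ ξ, ENNReal.ofReal (|ξ| ^ (2 * σ)) * ‖G ξ‖ₑ ^ 2 < ⊤ :=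
      lt_of_le_of_lt hle (ENNReal.mul_lt_top ENNReal.ofReal_lt_top
        (ENNReal.mul_lt_top hct.lt_top hFhom))
    exact ENNReal.lt_top_of_mul_ne_top_right this.ne hc0
  have hGw := sobolevWeight_lt_top hσ0 hGm (Lp.memLp G) hGhom
  have hG1 := integrable_of_sobolevWeight hσ.1 hGm hGw
  refine ⟨G, hGm, hGw, fun x => ?_⟩
  have hae : g =ᵐ[volume] 𝓕⁻ (G : ℝ → ℂ) := by
    have := Lp_fourierInv_toLp_ae_eq hG1 (Lp.memLp G)
    rw [Lp.toLp_coeFn] at this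
    exact hGg.symm.trans this
  exact congrFun ((continuous_fourierInv hG1).ae_eq_iff_eq volume hg |>.1 hae.symm).symm x

lemma norm_fourierInv_le (F : ℝ → ℂ) (x : ℝ) : ‖𝓕⁻ F x‖ ≤ ∫ ξ, ‖F ξ‖ := by
  rw [Real.fourierInv_eq]
  refine (norm_integral_le_integral_norm _).trans_eq ?_
  simp

/-- If `F` is supported in `[0, ∞)`, powers of `𝓕⁻ F` are orthogonal to Fourier transforms of
functions supported in `(-∞, 0)`. -/
lemma integral_pow_fourierInv_mul_eq_zero {F ψ : ℝ → ℂ} (hF : Integrable F)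
    (hFs : ∀ ξ < 0, F ξ = 0) (hψ : Integrable ψ) (hψs : ∀ η, 0 ≤ η → 𝓕⁻ ψ η = 0) (n : ℕ) :
    ∀ η, 0 ≤ η →
      ∫ x, ((Real.fourierChar (x * η) : Circle) : ℂ) * (𝓕⁻ F x ^ n * ψ x) = 0 := by
  have hint : ∀ (m : ℕ) (η : ℝ), Integrable fun x =>
      ((Real.fourierChar (x * η) : Circle) : ℂ) * (𝓕⁻ F x ^ m * ψ x) := by
    intro m η
    have hc := continuous_fourierInv hF
    have hc' : Continuous fun x : ℝ =>
        ((Real.fourierChar (x * η) : Circle) : ℂ) * 𝓕⁻ F x ^ m := by fun_prop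
    simp only [← mul_assoc]
    refine hψ.bdd_mul hc'.aestronglyMeasurable (c := (∫ ξ, ‖F ξ‖) ^ m)
      (Filter.Eventually.of_forall fun x => ?_)
    rw [norm_mul, Circle.norm_coe, one_mul, norm_pow]
    exact pow_le_pow_left₀ (norm_nonneg _) (norm_fourierInv_le F x) m
  induction n with
  | zero =>
    intro η hη
    have := hψs η hη
    rw [Real.fourierInv_eq] at this
    simpa [Circle.smul_def, mul_comm] using this
  | succ n ih =>
    intro η hη
    have h := integral_fourierInv_mul_eq_flip hF (hint n η)
    have h0 : ∀ ξ, F ξ * 𝓕⁻ (fun x =>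
        ((Real.fourierChar (x * η) : Circle) : ℂ) * (𝓕⁻ F x ^ n * ψ x)) ξ = 0 := by
      intro ξ
      rcases lt_or_ge ξ 0 with hξ | hξ
      · rw [hFs ξ hξ, zero_mul]
      · rw [Real.fourierInv_eq, ← mul_zero (F ξ), ← ih (ξ + η) (by positivity)]
        congr 2 with x
        have : x * (ξ + η) = inner ℝ x ξ + x * η := by simp; ring
        rw [this, AddChar.map_add_eq_mul, Circle.smul_def, Circle.coe_mul, smul_eq_mul, mul_assoc]
    simp only [h0, integral_zero] at h
    rw [← h]
    congr 1 with x
    ring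

lemma integral_exp_fourierInv_mul_eq_zero {F ψ : ℝ → ℂ} (hF : Integrable F)
    (hFs : ∀ ξ < 0, F ξ = 0) (hψ : Integrable ψ) (hψs : ∀ η, 0 ≤ η → 𝓕⁻ ψ η = 0) :
    ∫ x, Complex.exp (𝓕⁻ F x) * ψ x = 0 := by
  set R := ∫ ξ, ‖F ξ‖
  have hc := continuous_fourierInv hF
  have hbd : ∀ (n : ℕ) x, ‖𝓕⁻ F x ^ n / (n.factorial : ℂ)‖ ≤ R ^ n / n.factorial := by
    intro n x
    rw [norm_div, norm_pow, Complex.norm_natCast]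
    gcongr
    exact norm_fourierInv_le F x
  have hint : ∀ n : ℕ, Integrable fun x => 𝓕⁻ F x ^ n / (n.factorial : ℂ) * ψ x := fun n =>
    hψ.bdd_mul (by fun_prop) (Filter.Eventually.of_forall (hbd n))
  have hsum : Summable fun n : ℕ => ∫ x, ‖𝓕⁻ F x ^ n / (n.factorial : ℂ) * ψ x‖ := by
    refine Summable.of_nonneg_of_le (fun n => by positivity) (fun n => ?_)
      ((Real.summable_pow_div_factorial R).mul_right (∫ x, ‖ψ x‖))
    rw [← integral_const_mul]
    refine integral_mono (hint n).norm (hψ.norm.const_mul _) fun x => ?_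
    simp only [norm_mul]
    gcongr
    exact hbd n x
  have h := hasSum_integral_of_summable_integral_norm hint hsum
  have hz : ∀ n : ℕ, ∫ x, 𝓕⁻ F x ^ n / (n.factorial : ℂ) * ψ x = 0 := by
    intro n
    have := integral_pow_fourierInv_mul_eq_zero hF hFs hψ hψs n 0 le_rfl
    simp only [mul_zero, AddChar.map_zero_eq_one, Circle.coe_one, one_mul] at this
    rw [← zero_div (n.factorial : ℂ), ← this, ← integral_div]
    congr 1 with x
    ring
  simp only [hz] at h
  rw [← h.unique hasSum_zero]
  congr 1 with x
  rw [tsum_mul_right, Complex.exp_eq_exp_ℂ, NormedSpace.exp_eq_tsum_div]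

/-- The Fourier transform of `exp h - 1` is supported in `[0, ∞)` if that of `h` is. -/
lemma ae_eq_zero_of_fourierInv_eq_exp_sub_one {F G : ℝ → ℂ} (hF : Integrable F)
    (hFs : ∀ ξ < 0, F ξ = 0) (hG : Integrable G)
    (h : ∀ x, Complex.exp (𝓕⁻ F x) - 1 = 𝓕⁻ G x) :
    ∀ᵐ ξ, ξ ∈ Iio (0 : ℝ) → G ξ = 0 := by
  refine isOpen_Iio.ae_eq_zero_of_integral_contDiff_smul_eq_zero
    (hG.locallyIntegrable.locallyIntegrableOn _) fun φ hφ hc hs => ?_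
  have hc' : HasCompactSupport (Complex.ofRealCLM ∘ φ) := hc.comp_left rfl
  have hφ' : ContDiff ℝ ∞ (Complex.ofRealCLM ∘ φ) := by fun_prop
  set Φ : 𝓢(ℝ, ℂ) := hc'.toSchwartzMap hφ'
  set ψ : 𝓢(ℝ, ℂ) := 𝓕 Φ
  have hψΦ : 𝓕⁻ (ψ : ℝ → ℂ) = fun x => (φ x : ℂ) := by
    rw [← SchwartzMap.fourierInv_coe, FourierTransform.fourierInv_fourier_eq]
    rfl
  have hψs : ∀ η, 0 ≤ η → 𝓕⁻ (ψ : ℝ → ℂ) η = 0 := by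
    intro η hη
    have : η ∉ tsupport φ := fun hmem => absurd (hs hmem) (not_lt.2 hη)
    simp [hψΦ, image_eq_zero_of_notMem_tsupport this]
  have hexp := integral_exp_fourierInv_mul_eq_zero hF hFs ψ.integrable hψs
  have hone := integral_exp_fourierInv_mul_eq_zero (F := 0) (integrable_zero _ _ _)
    (fun _ _ => rfl) ψ.integrable hψs
  have h0 : ∀ x, 𝓕⁻ (0 : ℝ → ℂ) x = 0 := fun x => by simp [Real.fourierInv_eq]
  simp only [h0, Complex.exp_zero, one_mul] at hone
  have hexpint : Integrable fun x => Complex.exp (𝓕⁻ F x) * ψ x := by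
    have hcont := continuous_fourierInv hF
    refine ψ.integrable.bdd_mul (c := Real.exp (∫ ξ, ‖F ξ‖)) (by fun_prop)
      (Filter.Eventually.of_forall fun x => ?_)
    rw [Complex.norm_exp]
    exact Real.exp_le_exp.2 ((Complex.re_le_norm _).trans (norm_fourierInv_le F x))
  calc ∫ ξ, φ ξ • G ξ = ∫ ξ, 𝓕⁻ (ψ : ℝ → ℂ) ξ * G ξ := by simp [hψΦ]
    _ = ∫ x, ψ x * 𝓕⁻ G x := integral_fourierInv_mul_eq_flip ψ.integrable hG
    _ = ∫ x, (Complex.exp (𝓕⁻ F x) * ψ x - ψ x) := by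
        congr 1 with x
        rw [← h]
        ring
    _ = 0 := by rw [integral_sub hexpint ψ.integrable, hexp, hone, sub_zero]

lemma norm_exp_sub_exp_le {R : ℝ} {a b : ℂ} (ha : ‖a‖ ≤ R) (hb : ‖b‖ ≤ R) :
    ‖Complex.exp a - Complex.exp b‖ ≤ Real.exp R * ‖a - b‖ := by
  refine (convex_closedBall (0 : ℂ) R).norm_image_sub_le_of_norm_deriv_le
    (fun z _ => Complex.differentiableAt_exp) (fun z hz => ?_) (by simpa using hb)
    (by simpa using ha)
  rw [Complex.deriv_exp, Complex.norm_exp]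
  exact Real.exp_le_exp.2 ((Complex.re_le_norm z).trans (by simpa using hz))

lemma abs_log_sub_log_le {δ a b : ℝ} (hδ : 0 < δ) (ha : δ ≤ a) (hb : δ ≤ b) :
    |Real.log a - Real.log b| ≤ δ⁻¹ * |a - b| := by
  have key : ∀ {a b : ℝ}, δ ≤ a → δ ≤ b → Real.log a - Real.log b ≤ δ⁻¹ * |a - b| := by
    intro a b ha hb
    have ha0 := hδ.trans_le ha
    have hb0 := hδ.trans_le hb
    rw [← Real.log_div ha0.ne' hb0.ne']
    calc Real.log (a / b) ≤ a / b - 1 := Real.log_le_sub_one_of_pos (by positivity)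
      _ = b⁻¹ * (a - b) := by field_simp
      _ ≤ b⁻¹ * |a - b| := by gcongr; exact le_abs_self _
      _ ≤ δ⁻¹ * |a - b| := by gcongr
  rw [abs_le']
  refine ⟨key ha hb, ?_⟩
  rw [neg_sub, abs_sub_comm]
  exact key hb ha

lemma fourierInv_conj_comp_neg (F : ℝ → ℂ) (x : ℝ) :
    𝓕⁻ (fun ξ => conj (F (-ξ))) x = conj (𝓕⁻ F x) := by
  rw [Real.fourierInv_eq, Real.fourierInv_eq, ← integral_conj, ← integral_neg_eq_self]
  congr 1 with ξ
  rw [inner_neg_left, AddChar.map_neg_eq_inv, neg_neg, Circle.smul_def, Circle.smul_def,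
    Circle.coe_inv_eq_conj, smul_eq_mul, smul_eq_mul, map_mul]

lemma fourierInv_add_apply {F G : ℝ → ℂ} (hF : Integrable F) (hG : Integrable G) (x : ℝ) :
    𝓕⁻ (fun ξ => F ξ + G ξ) x = 𝓕⁻ F x + 𝓕⁻ G x := by
  have h : ∀ {K : ℝ → ℂ}, Integrable K →
      Integrable fun ξ : ℝ => Real.fourierChar (inner ℝ ξ x) • K ξ := by
    intro K hK
    simpa using (Real.fourierIntegral_convergent_iff (f := K) (-x)).2 hK
  simp only [Real.fourierInv_eq, smul_add]
  exact integral_add (h hF) (h hG)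

lemma fourierInv_const_mul (c : ℂ) (F : ℝ → ℂ) (x : ℝ) :
    𝓕⁻ (fun ξ => c * F ξ) x = c * 𝓕⁻ F x := by
  simp only [Real.fourierInv_eq, Circle.smul_def, smul_eq_mul, ← integral_const_mul]
  congr 1 with ξ
  ring

lemma sobolevWeight_const_mul_lt_top {σ : ℝ} {F : ℝ → ℂ} (c : ℂ) (h : sobolevWeight σ F < ⊤) :
    sobolevWeight σ (fun ξ => c * F ξ) < ⊤ := by
  have e : sobolevWeight σ (fun ξ => c * F ξ)
      = ENNReal.ofReal (‖c‖ ^ 2) * sobolevWeight σ F := by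
    rw [sobolevWeight, sobolevWeight, ← lintegral_const_mul' _ _ ENNReal.ofReal_ne_top]
    refine lintegral_congr fun ξ => ?_
    rw [← ENNReal.ofReal_mul (by positivity), norm_mul]
    ring_nf
  rw [e]
  exact ENNReal.mul_lt_top ENNReal.ofReal_lt_top h

lemma sobolevWeight_indicator_lt_top {σ : ℝ} {F : ℝ → ℂ} (s : Set ℝ)
    (h : sobolevWeight σ F < ⊤) : sobolevWeight σ (s.indicator F) < ⊤ := by
  refine lt_of_le_of_lt (lintegral_mono fun ξ => ENNReal.ofReal_le_ofReal ?_) h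
  gcongr
  exact norm_indicator_le_norm_self F ξ

lemma sobolevWeight_conj_comp_neg (σ : ℝ) (F : ℝ → ℂ) :
    sobolevWeight σ (fun ξ => conj (F (-ξ))) = sobolevWeight σ F := by
  rw [sobolevWeight, sobolevWeight, ← lintegral_neg_eq_self]
  simp

lemma sobolevWeight_add_lt_top {σ : ℝ} {F G : ℝ → ℂ} (hFm : Measurable F)
    (hF : sobolevWeight σ F < ⊤) (hG : sobolevWeight σ G < ⊤) :
    sobolevWeight σ (fun ξ => F ξ + G ξ) < ⊤ := by
  have hsum : ∫⁻ ξ : ℝ, ENNReal.ofReal 2 *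
      (ENNReal.ofReal ((|ξ| + 1) ^ (2 * σ) * ‖F ξ‖ ^ 2) +
        ENNReal.ofReal ((|ξ| + 1) ^ (2 * σ) * ‖G ξ‖ ^ 2)) < ⊤ := by
    rw [lintegral_const_mul' _ _ ENNReal.ofReal_ne_top, lintegral_add_left (by fun_prop)]
    exact ENNReal.mul_lt_top ENNReal.ofReal_lt_top (ENNReal.add_lt_top.2 ⟨hF, hG⟩)
  refine lt_of_le_of_lt (lintegral_mono fun ξ => ?_) hsum
  dsimp only
  rw [← ENNReal.ofReal_add (by positivity) (by positivity), ← ENNReal.ofReal_mul zero_le_two]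
  refine ENNReal.ofReal_le_ofReal ?_
  have h2 : ‖F ξ + G ξ‖ ^ 2 ≤ 2 * (‖F ξ‖ ^ 2 + ‖G ξ‖ ^ 2) :=
    (pow_le_pow_left₀ (norm_nonneg _) (norm_add_le _ _) 2).trans add_sq_le
  calc _ ≤ (|ξ| + 1) ^ (2 * σ) * (2 * (‖F ξ‖ ^ 2 + ‖G ξ‖ ^ 2)) := by gcongr
    _ = _ := by ring

/-- A real `H^σ` function is `h + conj h` with `h` in `H^σ` having Fourier transform supported
in `[0, ∞)`. -/
lemma exists_add_conj_eq {σ : ℝ} (hσ : 1 / 2 < σ) {V : ℝ → ℂ} (hV : Measurable V)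
    (hw : sobolevWeight σ V < ⊤) (hreal : ∀ x, conj (𝓕⁻ V x) = 𝓕⁻ V x) :
    ∃ F : ℝ → ℂ, Measurable F ∧ (∀ ξ < 0, F ξ = 0) ∧ sobolevWeight σ F < ⊤ ∧
      ∀ x, 𝓕⁻ F x + conj (𝓕⁻ F x) = 𝓕⁻ V x := by
  have hVi := integrable_of_sobolevWeight hσ hV hw
  set P := (Ici (0 : ℝ)).indicator V with hP
  set N := (Iio (0 : ℝ)).indicator V with hN
  have hPi : Integrable P := hVi.indicator measurableSet_Ici
  have hNi : Integrable N := hVi.indicator measurableSet_Iio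
  have hPm : Measurable P := hV.indicator measurableSet_Ici
  have hNm : Measurable N := hV.indicator measurableSet_Iio
  have hN' : Integrable fun ξ => conj (N (-ξ)) :=
    (LinearIsometryEquiv.integrable_comp_iff Complex.conjLIE).2 hNi.comp_neg
  have hPN : ∀ x, 𝓕⁻ V x = 𝓕⁻ P x + 𝓕⁻ N x := fun x => by
    rw [← fourierInv_add_apply hPi hNi]
    refine congrArg (fun K : ℝ → ℂ => 𝓕⁻ K x) (funext fun ξ => ?_)
    rcases lt_or_ge ξ 0 with h | h <;> simp [hP, hN, h, not_le.2, not_lt.2]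
  refine ⟨fun ξ => (1 / 2 : ℂ) * (P ξ + conj (N (-ξ))), ?_, fun ξ hξ => ?_, ?_, fun x => ?_⟩
  · have := Complex.continuous_conj.measurable
    fun_prop
  · have h1 : ¬ 0 ≤ ξ := not_le.2 hξ
    have h2 : ¬ 0 < ξ := not_lt.2 hξ.le
    simp [hP, hN, h1, h2]
  · refine sobolevWeight_const_mul_lt_top _
      (sobolevWeight_add_lt_top hPm (sobolevWeight_indicator_lt_top _ hw) ?_)
    rw [sobolevWeight_conj_comp_neg]
    exact sobolevWeight_indicator_lt_top _ hw
  · rw [fourierInv_const_mul, fourierInv_add_apply hPi hN', fourierInv_conj_comp_neg]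
    have h1 := hreal x
    rw [hPN, map_add] at h1
    rw [hPN, map_mul, map_add, Complex.conj_conj]
    have : conj (1 / 2 : ℂ) = 1 / 2 := by rw [map_div₀, map_one, Complex.conj_ofNat]
    rw [this]
    linear_combination (1 / 2 : ℂ) * h1

/-- Wiener–Hopf factorization, for the Fourier transform normalised as in Mathlib. -/
lemma exists_wienerHopf_fourierInv {σ : ℝ} (hσ : σ ∈ Ioo (1 / 2 : ℝ) 1) {U : ℝ → ℂ}
    (hU : Measurable U) (hw : sobolevWeight σ U < ⊤) {u : ℝ → ℝ}
    (hu : ∀ x, (u x : ℂ) = 𝓕⁻ U x) {δ : ℝ} (hδ : 0 < δ) (hδu : ∀ x, δ ≤ 1 + u x) :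
    ∃ M : ℝ → ℂ, Measurable M ∧ (∀ ξ < 0, M ξ = 0) ∧ sobolevWeight σ M < ⊤ ∧
      ∀ x, (1 + 𝓕⁻ M x) * (1 + conj (𝓕⁻ M x)) = 1 + (u x : ℂ) := by
  have hucont : Continuous u := by
    have h : (fun x => (u x : ℂ)) = 𝓕⁻ U := funext hu
    have hc := continuous_fourierInv (integrable_of_sobolevWeight hσ.1 hU hw)
    rw [← h] at hc
    exact Complex.isUniformEmbedding_ofReal.isEmbedding.continuous_iff.2 hc
  have hpos : ∀ x, 0 < 1 + u x := fun x => hδ.trans_le (hδu x)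
  have hε : 0 < min δ 1 := lt_min hδ one_pos
  have hεu : ∀ x, min δ 1 ≤ 1 + u x := fun x => (min_le_left _ _).trans (hδu x)
  obtain ⟨V, hVm, hVw, hV⟩ := exists_sobolev_of_dominated hσ hU hw
    (g := fun x => (Real.log (1 + u x) : ℂ)) (C := (min δ 1)⁻¹)
    (Complex.continuous_ofReal.comp
      ((continuous_const.add hucont).log fun x => (hpos x).ne'))
    (fun x => by
      have := abs_log_sub_log_le hε (hεu x) (min_le_right δ 1)
      rw [Real.log_one, sub_zero, add_sub_cancel_left] at this
      simpa only [← hu, Complex.norm_real, Real.norm_eq_abs] using this)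
    (fun x y => by
      have := abs_log_sub_log_le hε (hεu x) (hεu y)
      rw [add_sub_add_left_eq_sub] at this
      simpa only [← hu, ← Complex.ofReal_sub, Complex.norm_real, Real.norm_eq_abs] using this)
  obtain ⟨F, hFm, hFs, hFw, hF⟩ := exists_add_conj_eq hσ.1 hVm hVw fun x => by
    rw [← hV, Complex.conj_ofReal]
  have hFi := integrable_of_sobolevWeight hσ.1 hFm hFw
  obtain ⟨G, hGm, hGw, hG⟩ := exists_sobolev_of_dominated hσ hFm hFw
    (g := fun x => Complex.exp (𝓕⁻ F x) - 1) (C := Real.exp (∫ ξ, ‖F ξ‖))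
    ((continuous_fourierInv hFi).cexp.sub continuous_const)
    (fun x => by
      simpa using norm_exp_sub_exp_le (b := 0) (norm_fourierInv_le F x)
        (by rw [norm_zero]; positivity))
    (fun x y => by
      simpa using norm_exp_sub_exp_le (norm_fourierInv_le F x) (norm_fourierInv_le F y))
  have hG0 := ae_eq_zero_of_fourierInv_eq_exp_sub_one hFi hFs
    (integrable_of_sobolevWeight hσ.1 hGm hGw) hG
  have hM : ∀ x, 𝓕⁻ ((Ici (0 : ℝ)).indicator G) x = Complex.exp (𝓕⁻ F x) - 1 := by
    intro x
    rw [hG]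
    refine Real.fourierInv_congr_ae ?_ x
    filter_upwards [hG0] with ξ hξ
    rcases lt_or_ge ξ 0 with h | h
    · rw [hξ h, indicator_of_notMem (by simpa using h)]
    · rw [indicator_of_mem (by simpa using h)]
  refine ⟨(Ici (0 : ℝ)).indicator G, hGm.indicator measurableSet_Ici,
    fun ξ hξ => indicator_of_notMem (by simpa using hξ) _,
    sobolevWeight_indicator_lt_top _ hGw, fun x => ?_⟩
  rw [hM, map_sub, map_one, add_sub_cancel, add_sub_cancel, ← Complex.exp_conj, ← Complex.exp_add,
    hF, ← hV, ← Complex.ofReal_exp, Real.exp_log (hpos x)]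
  push_cast
  rfl

lemma IFT_eq_fourierInv (F : ℝ → ℂ) (x : ℝ) :
    IFT F x = ((Real.sqrt (2 * Real.pi) : ℝ) : ℂ)⁻¹ * 𝓕⁻ F (x / (2 * Real.pi)) := by
  rw [IFT, Complex.ofReal_inv, Real.fourierInv_eq]
  congr 2 with ξ
  rw [Circle.smul_def, Real.fourierChar_apply, smul_eq_mul]
  congr 2
  have : (Real.pi : ℂ) ≠ 0 := by exact_mod_cast Real.pi_ne_zero
  simp
  field_simp

/-- Wiener–Hopf factorization: if `u : ℝ → ℝ` is continuous, lies in
`H^σ(ℝ)` for some `σ ∈ (1/2, 1)` (here represented as the inverse Fourier transform of `U`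
with `∫ (|ξ|+1)^{2σ}|U|² < ∞`; note `U ∈ L¹` since `σ > 1/2`), and satisfies
`inf (1 + u) > 0`, then there is `μ ∈ H^σ(ℝ)` with Fourier transform `M` supported in
`[0,∞)` such that `(1+μ)(1+conj μ) = 1+u` pointwise. -/
theorem stmt15 (σ : ℝ) (hσ : σ ∈ Set.Ioo (1/2 : ℝ) 1)
    (u : ℝ → ℝ) (U : ℝ → ℂ)
    (hu : Continuous u)
    (hU : Measurable U)
    (hUnorm : (∫⁻ ξ : ℝ, ENNReal.ofReal ((|ξ| + 1) ^ (2 * σ) * ‖U ξ‖ ^ 2)) < ⊤)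
    (hrep : ∀ x : ℝ, (u x : ℂ) = IFT U x)
    (hinf : 0 < ⨅ x : ℝ, (1 + u x)) :
    ∃ μ M : ℝ → ℂ, Measurable M ∧ (∀ ξ : ℝ, ξ < 0 → M ξ = 0) ∧
      (∫⁻ ξ : ℝ, ENNReal.ofReal ((|ξ| + 1) ^ (2 * σ) * ‖M ξ‖ ^ 2)) < ⊤ ∧
      (∀ x : ℝ, μ x = IFT M x) ∧
      ∀ x : ℝ, (1 + μ x) * (1 + conj (μ x)) = 1 + (u x : ℂ) := by
  have hs : ((Real.sqrt (2 * Real.pi) : ℝ) : ℂ) ≠ 0 := by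
    exact_mod_cast (Real.sqrt_pos.2 Real.two_pi_pos).ne'
  set s : ℂ := ((Real.sqrt (2 * Real.pi) : ℝ) : ℂ)
  have hbdd : BddBelow (range fun x => 1 + u x) := by
    by_contra h
    exact hinf.ne' (Real.iInf_of_not_bddBelow h)
  obtain ⟨M, hMm, hMs, hMw, hM⟩ := exists_wienerHopf_fourierInv hσ
    (U := fun ξ => s⁻¹ * U ξ) (u := fun x => u (2 * Real.pi * x)) (hU.const_mul _)
    (sobolevWeight_const_mul_lt_top _ hUnorm)
    (fun x => by
      rw [hrep, IFT_eq_fourierInv, mul_div_cancel_left₀ _ Real.two_pi_pos.ne',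
        fourierInv_const_mul])
    hinf (fun x => ciInf_le hbdd _)
  have hμ : ∀ x, IFT (fun ξ => s * M ξ) x = 𝓕⁻ M (x / (2 * Real.pi)) := fun x => by
    rw [IFT_eq_fourierInv, fourierInv_const_mul, inv_mul_cancel_left₀ hs]
  refine ⟨_, fun ξ => s * M ξ, hMm.const_mul _, fun ξ hξ => by simp [hMs ξ hξ],
    sobolevWeight_const_mul_lt_top _ hMw, fun x => rfl, fun x => ?_⟩
  rw [hμ, hM, mul_div_cancel₀ _ Real.two_pi_pos.ne']
end
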